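/- Let d ≥ 3 and 1 ≤ p ≤ 2. Then there exist constants c, C > 0 such that for every integer n ≥ 1: (a) every spherical harmonic Y_n of degree n on S^{d-1} satisfies ‖Y_n‖_{p'} ≤ C · n^{(d−2)(1/p − 1/2)} · ‖Y_n‖_p; and (b) this estimate is sharp: there exists a nonzero spherical harmonic Y_n of degree n on S^{d-1} with ‖Y_n‖_{p'} ≥ c · n^{(d−2)(1/p − 1/2)} · ‖Y_n‖_p. -/

import Mathlib

open MeasureTheory Metric
open scoped ENNReal

noncomputable section

/-- The unit sphere `S^{d-1}` in `ℝ^d`. -/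
abbrev Sph (d : ℕ) := Metric.sphere (0 : EuclideanSpace ℝ (Fin d)) 1

/-- The surface measure `σ` on the unit sphere in `ℝ^d`. -/
def sphMeasure (d : ℕ) : Measure (Sph d) :=
  (volume : Measure (EuclideanSpace ℝ (Fin d))).toSphere

/-- `Y : S^{d-1} → ℝ` is a spherical harmonic of degree `n` if it is the restriction to
`S^{d-1}` of a polynomial in `d` real variables that is homogeneous of degree `n` and
harmonic (the sum of its second partial derivatives vanishes identically). -/
def IsSphericalHarmonic (d n : ℕ) (Y : Sph d → ℝ) : Prop :=
  ∃ P : MvPolynomial (Fin d) ℝ, P.IsHomogeneous n ∧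
    (∑ i : Fin d, MvPolynomial.pderiv i (MvPolynomial.pderiv i P)) = 0 ∧
    ∀ x : Sph d, Y x = MvPolynomial.eval (fun i => (x : EuclideanSpace ℝ (Fin d)) i) P

/-- The Laplacian on polynomials. -/
def polyLaplacian (d : ℕ) : MvPolynomial (Fin d) ℝ →ₗ[ℝ] MvPolynomial (Fin d) ℝ :=
  ∑ i : Fin d, (MvPolynomial.pderiv i).toLinearMap ∘ₗ (MvPolynomial.pderiv i).toLinearMap

/-- The polynomial `|x|²`. -/
def normSqPoly (d : ℕ) : MvPolynomial (Fin d) ℝ := ∑ i : Fin d, MvPolynomial.X i ^ 2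

/-- Homogeneous harmonic polynomials of degree `k`. -/
def IsSolidHarmonic (d k : ℕ) (P : MvPolynomial (Fin d) ℝ) : Prop :=
  P.IsHomogeneous k ∧ polyLaplacian d P = 0

theorem polyLaplacian_apply {d : ℕ} (P : MvPolynomial (Fin d) ℝ) :
    polyLaplacian d P = ∑ i : Fin d, MvPolynomial.pderiv i (MvPolynomial.pderiv i P) := by
  simp [polyLaplacian]

theorem polyLaplacian_mul {d : ℕ} (P Q : MvPolynomial (Fin d) ℝ) :
    polyLaplacian d (P * Q) = polyLaplacian d P * Q +
      2 * ∑ i : Fin d, MvPolynomial.pderiv i P * MvPolynomial.pderiv i Q +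
      P * polyLaplacian d Q := by
  simp only [polyLaplacian_apply, Derivation.leibniz, map_add, smul_eq_mul, Finset.sum_mul,
    Finset.mul_sum, ← Finset.sum_add_distrib]
  exact Finset.sum_congr rfl fun i _ => by ring

theorem pderiv_normSqPoly {d : ℕ} (i : Fin d) :
    MvPolynomial.pderiv i (normSqPoly d) = 2 * MvPolynomial.X i := by
  classical
  simp [normSqPoly, Derivation.leibniz_pow, MvPolynomial.pderiv_X, Pi.single_apply]

theorem polyLaplacian_normSqPoly {d : ℕ} :
    polyLaplacian d (normSqPoly d) = MvPolynomial.C (2 * (d : ℝ)) := by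
  have h (i : Fin d) : MvPolynomial.pderiv i (2 * MvPolynomial.X i : MvPolynomial (Fin d) ℝ) =
      MvPolynomial.C 2 := by
    rw [← map_ofNat MvPolynomial.C 2, MvPolynomial.pderiv_C_mul]
    simp
  simp only [polyLaplacian_apply, pderiv_normSqPoly, h]
  simp [mul_comm]

theorem normSqPoly_isHomogeneous (d : ℕ) : (normSqPoly d).IsHomogeneous 2 :=
  MvPolynomial.IsHomogeneous.sum _ _ _ fun i _ => by
    simpa using (MvPolynomial.isHomogeneous_X ℝ i).pow 2

theorem polyLaplacian_normSqPoly_mul {d q : ℕ} {Q : MvPolynomial (Fin d) ℝ}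
    (hQ : Q.IsHomogeneous q) :
    polyLaplacian d (normSqPoly d * Q) =
      MvPolynomial.C (2 * (d : ℝ) + 4 * q) * Q + normSqPoly d * polyLaplacian d Q := by
  have h : ∑ i : Fin d, MvPolynomial.pderiv i (normSqPoly d) * MvPolynomial.pderiv i Q =
      2 * (q • Q) := by
    rw [← hQ.sum_X_mul_pderiv, Finset.mul_sum]
    exact Finset.sum_congr rfl fun i _ => by rw [pderiv_normSqPoly]; ring
  rw [polyLaplacian_mul, polyLaplacian_normSqPoly, h]
  simp only [map_add, map_mul, nsmul_eq_mul, map_natCast, map_ofNat]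
  ring

theorem normSqPoly_pow_mul_isHomogeneous {d k : ℕ} {H : MvPolynomial (Fin d) ℝ}
    (hH : H.IsHomogeneous k) (j : ℕ) : (normSqPoly d ^ j * H).IsHomogeneous (2 * j + k) :=
  ((normSqPoly_isHomogeneous d).pow j).mul hH

theorem polyLaplacian_normSqPoly_pow_mul {d k : ℕ} {H : MvPolynomial (Fin d) ℝ}
    (hH : IsSolidHarmonic d k H) (j : ℕ) :
    polyLaplacian d (normSqPoly d ^ (j + 1) * H) =
      MvPolynomial.C (2 * ((j : ℝ) + 1) * (d + 2 * k + 2 * j)) * (normSqPoly d ^ j * H) := by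
  induction j with
  | zero =>
    rw [zero_add, pow_one, polyLaplacian_normSqPoly_mul hH.1, hH.2, pow_zero]
    simp only [mul_zero, add_zero, one_mul]
    congr 2
    push_cast
    ring
  | succ j ih =>
    rw [pow_succ', mul_assoc,
      polyLaplacian_normSqPoly_mul (normSqPoly_pow_mul_isHomogeneous hH.1 (j + 1)), ih]
    have h : ∀ (a b c : ℝ) (R : MvPolynomial (Fin d) ℝ), a + b = c →
        MvPolynomial.C a * (normSqPoly d ^ (j + 1) * R) +
          normSqPoly d * (MvPolynomial.C b * (normSqPoly d ^ j * R)) =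
        MvPolynomial.C c * (normSqPoly d ^ (j + 1) * R) := by
      rintro a b c R rfl
      rw [map_add]; ring
    apply h
    push_cast
    ring

/-- The span of the products `|x|^{2j} H` of degree `q` with `H` solid harmonic. -/
def harmonicSpan (d q : ℕ) : Submodule ℝ (MvPolynomial (Fin d) ℝ) :=
  Submodule.span ℝ {P | ∃ j k H, 2 * j + k = q ∧ IsSolidHarmonic d k H ∧ P = normSqPoly d ^ j * H}

theorem isHomogeneous_of_mem_harmonicSpan {d q : ℕ} {P : MvPolynomial (Fin d) ℝ}
    (hP : P ∈ harmonicSpan d q) : P.IsHomogeneous q := by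
  rw [← MvPolynomial.mem_homogeneousSubmodule]
  refine Submodule.span_le.2 ?_ hP
  rintro _ ⟨j, k, H, rfl, hH, rfl⟩
  exact normSqPoly_pow_mul_isHomogeneous hH.1 j

theorem exists_polyLaplacian_eq {d q : ℕ} (hd : 0 < d) {P : MvPolynomial (Fin d) ℝ}
    (hP : P ∈ harmonicSpan d q) : ∃ R ∈ harmonicSpan d (q + 2), polyLaplacian d R = P := by
  suffices h : harmonicSpan d q ≤ (harmonicSpan d (q + 2)).map (polyLaplacian d) from
    Submodule.mem_map.1 (h hP)
  refine Submodule.span_le.2 ?_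
  rintro _ ⟨j, k, H, rfl, hH, rfl⟩
  have hc : (2 * ((j : ℝ) + 1) * (d + 2 * k + 2 * j)) ≠ 0 := by positivity
  refine Submodule.mem_map.2 ⟨(2 * ((j : ℝ) + 1) * (d + 2 * k + 2 * j))⁻¹ •
    (normSqPoly d ^ (j + 1) * H), Submodule.smul_mem _ _
      (Submodule.subset_span ⟨j + 1, k, H, by ring, hH, rfl⟩), ?_⟩
  rw [map_smul, polyLaplacian_normSqPoly_pow_mul hH, ← MvPolynomial.smul_eq_C_mul, smul_smul,
    inv_mul_cancel₀ hc, one_smul]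

theorem polyLaplacian_isHomogeneous {d q : ℕ} {P : MvPolynomial (Fin d) ℝ}
    (hP : P.IsHomogeneous q) : (polyLaplacian d P).IsHomogeneous (q - 2) := by
  rw [polyLaplacian_apply]
  exact MvPolynomial.IsHomogeneous.sum _ _ _ fun i _ => hP.pderiv.pderiv

theorem polyLaplacian_eq_zero_of_lt_two {d q : ℕ} {P : MvPolynomial (Fin d) ℝ}
    (hP : P.IsHomogeneous q) (hq : q < 2) : polyLaplacian d P = 0 := by
  rw [polyLaplacian_apply]
  refine Finset.sum_eq_zero fun i _ => ?_
  have h : (MvPolynomial.pderiv i P).IsHomogeneous 0 := by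
    simpa [show q - 1 = 0 by omega] using hP.pderiv (i := i)
  rw [MvPolynomial.totalDegree_eq_zero_iff_eq_C.1
    (Nat.le_zero.1 h.totalDegree_le), MvPolynomial.pderiv_C]

theorem mem_harmonicSpan {d : ℕ} (hd : 0 < d) (q : ℕ) :
    ∀ P : MvPolynomial (Fin d) ℝ, P.IsHomogeneous q → P ∈ harmonicSpan d q := by
  induction q using Nat.strong_induction_on with
  | _ q ih =>
    have key {P : MvPolynomial (Fin d) ℝ} (hP : IsSolidHarmonic d q P) : P ∈ harmonicSpan d q :=
      Submodule.subset_span ⟨0, q, P, by ring, hP, by simp⟩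
    intro P hP
    rcases lt_or_ge q 2 with hq | hq
    · exact key ⟨hP, polyLaplacian_eq_zero_of_lt_two hP hq⟩
    · obtain ⟨R, hR, hRP⟩ := exists_polyLaplacian_eq hd
        (ih (q - 2) (by omega) _ (polyLaplacian_isHomogeneous hP))
      rw [Nat.sub_add_cancel hq] at hR
      have := key (P := P - R) ⟨hP.sub (isHomogeneous_of_mem_harmonicSpan hR), by
        rw [map_sub, hRP, sub_self]⟩
      simpa using Submodule.add_mem _ this hR

/-- The value of a polynomial at a point of Euclidean space. -/
def polyEval {d : ℕ} (P : MvPolynomial (Fin d) ℝ) (y : EuclideanSpace ℝ (Fin d)) : ℝ :=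
  MvPolynomial.eval (fun i => y i) P

@[simp] theorem polyEval_add {d : ℕ} (P Q : MvPolynomial (Fin d) ℝ)
    (y : EuclideanSpace ℝ (Fin d)) : polyEval (P + Q) y = polyEval P y + polyEval Q y :=
  map_add _ _ _

@[simp] theorem polyEval_sub {d : ℕ} (P Q : MvPolynomial (Fin d) ℝ)
    (y : EuclideanSpace ℝ (Fin d)) : polyEval (P - Q) y = polyEval P y - polyEval Q y :=
  map_sub _ _ _

@[simp] theorem polyEval_mul {d : ℕ} (P Q : MvPolynomial (Fin d) ℝ)
    (y : EuclideanSpace ℝ (Fin d)) : polyEval (P * Q) y = polyEval P y * polyEval Q y :=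
  map_mul _ _ _

@[simp] theorem polyEval_pow {d : ℕ} (P : MvPolynomial (Fin d) ℝ) (n : ℕ)
    (y : EuclideanSpace ℝ (Fin d)) : polyEval (P ^ n) y = polyEval P y ^ n :=
  map_pow _ _ _

@[simp] theorem polyEval_C {d : ℕ} (c : ℝ) (y : EuclideanSpace ℝ (Fin d)) :
    polyEval (MvPolynomial.C c) y = c :=
  MvPolynomial.eval_C _

@[simp] theorem polyEval_X {d : ℕ} (i : Fin d) (y : EuclideanSpace ℝ (Fin d)) :
    polyEval (MvPolynomial.X i) y = y i :=
  MvPolynomial.eval_X _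

@[simp] theorem polyEval_zero {d : ℕ} (y : EuclideanSpace ℝ (Fin d)) :
    polyEval 0 y = 0 :=
  map_zero _

theorem polyEval_sum {d : ℕ} {ι : Type*} (s : Finset ι) (f : ι → MvPolynomial (Fin d) ℝ)
    (y : EuclideanSpace ℝ (Fin d)) : polyEval (∑ i ∈ s, f i) y = ∑ i ∈ s, polyEval (f i) y :=
  map_sum _ _ _

theorem polyEval_normSqPoly {d : ℕ} (y : EuclideanSpace ℝ (Fin d)) :
    polyEval (normSqPoly d) y = ‖y‖ ^ 2 := by
  simp [normSqPoly, polyEval_sum, EuclideanSpace.norm_sq_eq]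

theorem continuous_polyEval {d : ℕ} (P : MvPolynomial (Fin d) ℝ) :
    Continuous (polyEval P) :=
  (MvPolynomial.continuous_eval P).comp (continuous_pi fun i => by fun_prop)

theorem polyEval_smul_of_isHomogeneous {d n : ℕ} {P : MvPolynomial (Fin d) ℝ}
    (hP : P.IsHomogeneous n) (r : ℝ) (y : EuclideanSpace ℝ (Fin d)) :
    polyEval P (r • y) = r ^ n * polyEval P y := by
  simp only [polyEval, MvPolynomial.eval_eq', Finset.mul_sum]
  refine Finset.sum_congr rfl fun a ha => ?_
  have h := hP (MvPolynomial.mem_support_iff.1 ha)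
  have h' : ∑ i, a i = n := by
    rw [← h, Finsupp.weight_apply, Finsupp.sum_fintype] <;> simp
  simp only [PiLp.smul_apply, smul_eq_mul, mul_pow, Finset.prod_mul_distrib,
    Finset.prod_pow_eq_pow_sum, h']
  ring

theorem hasFDerivAt_polyEval {d : ℕ} (P : MvPolynomial (Fin d) ℝ)
    (y : EuclideanSpace ℝ (Fin d)) :
    HasFDerivAt (polyEval P) (∑ i, polyEval (MvPolynomial.pderiv i P) y •
      (EuclideanSpace.proj i : EuclideanSpace ℝ (Fin d) →L[ℝ] ℝ)) y := by
  classical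
  induction P using MvPolynomial.induction_on with
  | C c =>
    have h : polyEval (MvPolynomial.C c : MvPolynomial (Fin d) ℝ) = fun _ => c :=
      funext fun z => polyEval_C c z
    rw [h]
    simpa using hasFDerivAt_const (𝕜 := ℝ) c y
  | add P Q hP hQ =>
    have := hP.add hQ
    simp only [map_add, polyEval_add, add_smul, Finset.sum_add_distrib]
    exact this.congr_of_eventuallyEq (.of_forall fun z => polyEval_add P Q z)
  | mul_X P j hP =>
    have h := hP.mul (EuclideanSpace.proj j : EuclideanSpace ℝ (Fin d) →L[ℝ] ℝ).hasFDerivAt (x := y)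
    refine (h.congr_of_eventuallyEq (.of_forall fun z => ?_)).congr_fderiv ?_
    · simp
    · ext v
      have hX (i : Fin d) : polyEval (Pi.single (M := fun _ => MvPolynomial (Fin d) ℝ) i 1 j) y =
          if j = i then 1 else 0 := by
        rw [Pi.single_apply]
        split_ifs <;> simp [polyEval]
      simp [Derivation.leibniz, hX, add_mul, Finset.sum_add_distrib, Finset.mul_sum, mul_assoc]

theorem abs_polyEval_le_exp {d : ℕ} (P : MvPolynomial (Fin d) ℝ) :
    ∀ b : ℝ, 0 < b → ∃ C : ℝ, ∀ y, |polyEval P y| ≤ C * Real.exp (b * ‖y‖ ^ 2) := by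
  induction P using MvPolynomial.induction_on with
  | C c =>
    refine fun b hb => ⟨|c|, fun y => ?_⟩
    rw [polyEval_C]
    exact le_mul_of_one_le_right (abs_nonneg c) (Real.one_le_exp (by positivity))
  | add P Q hP hQ =>
    intro b hb
    obtain ⟨C, hC⟩ := hP b hb
    obtain ⟨D, hD⟩ := hQ b hb
    refine ⟨C + D, fun y => ?_⟩
    rw [polyEval_add, add_mul]
    exact (abs_add_le _ _).trans (add_le_add (hC y) (hD y))
  | mul_X P j hP =>
    intro b hb
    obtain ⟨C, hC⟩ := hP (b / 2) (by positivity)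
    refine ⟨C * (1 + 2 / b), fun y => ?_⟩
    have h1 : |y j| ≤ (1 + 2 / b) * Real.exp (b / 2 * ‖y‖ ^ 2) := by
      have h2 : |y j| ≤ ‖y‖ := by simpa using PiLp.norm_apply_le y j
      have h3 := Real.add_one_le_exp (b / 2 * ‖y‖ ^ 2)
      have h4 : ‖y‖ ≤ 1 + ‖y‖ ^ 2 := by nlinarith [sq_nonneg (‖y‖ - 1), norm_nonneg y]
      calc |y j| ≤ 1 + ‖y‖ ^ 2 := h2.trans h4
        _ ≤ (1 + 2 / b) * (b / 2 * ‖y‖ ^ 2 + 1) := by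
          have : (1 + 2 / b) * (b / 2 * ‖y‖ ^ 2 + 1) =
            1 + ‖y‖ ^ 2 + (b / 2 * ‖y‖ ^ 2 + 2 / b) := by field_simp; ring
          rw [this]
          have : 0 ≤ b / 2 * ‖y‖ ^ 2 + 2 / b := by positivity
          linarith
        _ ≤ _ := by gcongr
    rw [polyEval_mul, polyEval_X, abs_mul]
    calc |polyEval P y| * |y j| ≤ (C * Real.exp (b / 2 * ‖y‖ ^ 2)) *
          ((1 + 2 / b) * Real.exp (b / 2 * ‖y‖ ^ 2)) :=
          mul_le_mul (hC y) h1 (abs_nonneg _) ((abs_nonneg _).trans (hC y))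
      _ = C * (1 + 2 / b) * (Real.exp (b / 2 * ‖y‖ ^ 2) * Real.exp (b / 2 * ‖y‖ ^ 2)) := by ring
      _ = _ := by rw [← Real.exp_add]; ring_nf

theorem integrable_polyEval_mul_gaussian {d : ℕ} (P : MvPolynomial (Fin d) ℝ) :
    Integrable (fun y : EuclideanSpace ℝ (Fin d) =>
      polyEval P y * Real.exp (-(1 / 2) * ‖y‖ ^ 2)) := by
  obtain ⟨C, hC⟩ := abs_polyEval_le_exp P (1 / 4) (by norm_num)
  have h1 : Integrable (fun y : EuclideanSpace ℝ (Fin d) => Real.exp (-(1 / 4) * ‖y‖ ^ 2)) := by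
    have h := (GaussianFourier.integrable_cexp_neg_mul_sq_norm_add (V := EuclideanSpace ℝ (Fin d))
      (b := 1 / 4) (by norm_num) 0 0).re
    refine h.congr (.of_forall fun y => ?_)
    simp only []
    rw [show (-(1 / 4 : ℂ) * (‖y‖ : ℂ) ^ 2 + 0 * (inner ℝ (0 : EuclideanSpace ℝ (Fin d)) y : ℝ)) =
      ((-(1 / 4) * ‖y‖ ^ 2 : ℝ) : ℂ) by push_cast; ring, ← Complex.ofReal_exp]
    rfl
  refine (h1.const_mul C).mono'
    ((continuous_polyEval P).mul (by fun_prop)).aestronglyMeasurable (.of_forall fun y => ?_)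
  rw [Real.norm_eq_abs, abs_mul, abs_of_pos (Real.exp_pos _)]
  calc |polyEval P y| * Real.exp (-(1 / 2) * ‖y‖ ^ 2)
      ≤ C * Real.exp (1 / 4 * ‖y‖ ^ 2) * Real.exp (-(1 / 2) * ‖y‖ ^ 2) := by gcongr; exact hC y
    _ = _ := by rw [mul_assoc, ← Real.exp_add]; ring_nf

/-- The unnormalised Gaussian integral of a polynomial. -/
def gaussianIntegral {d : ℕ} (P : MvPolynomial (Fin d) ℝ) : ℝ :=
  ∫ y : EuclideanSpace ℝ (Fin d), polyEval P y * Real.exp (-(1 / 2) * ‖y‖ ^ 2)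

theorem gaussianIntegral_sum {d : ℕ} {ι : Type*} (s : Finset ι)
    (f : ι → MvPolynomial (Fin d) ℝ) :
    gaussianIntegral (∑ i ∈ s, f i) = ∑ i ∈ s, gaussianIntegral (f i) := by
  simp only [gaussianIntegral, polyEval_sum, Finset.sum_mul]
  exact integral_finsetSum _ fun i _ => integrable_polyEval_mul_gaussian (f i)

theorem gaussianIntegral_X_mul {d : ℕ} (i : Fin d) (P : MvPolynomial (Fin d) ℝ) :
    gaussianIntegral (MvPolynomial.X i * P) = gaussianIntegral (MvPolynomial.pderiv i P) := by
  classical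
  have hg (y : EuclideanSpace ℝ (Fin d)) :
      HasFDerivAt (fun y : EuclideanSpace ℝ (Fin d) => Real.exp (-(1 / 2) * ‖y‖ ^ 2))
        (Real.exp (-(1 / 2) * ‖y‖ ^ 2) • (-(1 / 2 : ℝ)) • ((2 : ℕ) • innerSL ℝ y)) y :=
    ((hasStrictFDerivAt_norm_sq y).hasFDerivAt.const_mul _).exp
  set v : EuclideanSpace ℝ (Fin d) := EuclideanSpace.single i 1
  have e1 (y : EuclideanSpace ℝ (Fin d)) :
      fderiv ℝ (polyEval P) y v = polyEval (MvPolynomial.pderiv i P) y := by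
    rw [(hasFDerivAt_polyEval P y).fderiv]
    simp [v]
  have e2 (y : EuclideanSpace ℝ (Fin d)) :
      fderiv ℝ (fun y : EuclideanSpace ℝ (Fin d) => Real.exp (-(1 / 2) * ‖y‖ ^ 2)) y v =
        -(y i * Real.exp (-(1 / 2) * ‖y‖ ^ 2)) := by
    rw [(hg y).fderiv]
    simp [v, EuclideanSpace.inner_single_right]
    ring
  have h := integral_mul_fderiv_eq_neg_fderiv_mul_of_integrable
    (μ := (volume : Measure (EuclideanSpace ℝ (Fin d)))) (f := polyEval P)
    (g := fun y => Real.exp (-(1 / 2) * ‖y‖ ^ 2)) (v := v)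
    (by simpa only [e1] using integrable_polyEval_mul_gaussian _)
    (by
      simp only [e2]
      refine (integrable_polyEval_mul_gaussian (MvPolynomial.X i * P)).neg.congr
        (.of_forall fun y => ?_)
      simp; ring)
    (integrable_polyEval_mul_gaussian P)
    (fun y _ => (hasFDerivAt_polyEval P y).differentiableAt)
    (fun y _ => (hg y).differentiableAt)
  simp only [e1, e2] at h
  have h' := neg_eq_iff_eq_neg.2 h
  rw [neg_eq_iff_eq_neg, ← neg_eq_iff_eq_neg, ← integral_neg] at h'
  rw [gaussianIntegral, gaussianIntegral, ← h']
  exact integral_congr_ae (.of_forall fun y => by simp; ring)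

theorem gaussianIntegral_polyLaplacian {d n : ℕ} {P : MvPolynomial (Fin d) ℝ}
    (hP : P.IsHomogeneous n) :
    gaussianIntegral (polyLaplacian d P) = n * gaussianIntegral P := by
  rw [polyLaplacian_apply, gaussianIntegral_sum]
  simp only [← gaussianIntegral_X_mul]
  rw [← gaussianIntegral_sum, hP.sum_X_mul_pderiv, gaussianIntegral, gaussianIntegral,
    ← integral_const_mul]
  exact integral_congr_ae (.of_forall fun y => by simp [polyEval, mul_assoc])

instance isFiniteMeasure_sphMeasure (d : ℕ) : IsFiniteMeasure (sphMeasure d) := by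
  unfold sphMeasure; infer_instance

/-- The integral of a polynomial over the unit sphere. -/
def sphereIntegral {d : ℕ} (P : MvPolynomial (Fin d) ℝ) : ℝ :=
  ∫ x : Sph d, polyEval P (x : EuclideanSpace ℝ (Fin d)) ∂(sphMeasure d)

theorem gaussianIntegral_eq_mul_sphereIntegral {d n : ℕ} (hd : 0 < d)
    {P : MvPolynomial (Fin d) ℝ} (hP : P.IsHomogeneous n) :
    gaussianIntegral P = sphereIntegral P *
      ∫ r in Set.Ioi (0 : ℝ), r ^ (n + d - 1) * Real.exp (-(1 / 2) * r ^ 2) := by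
  have : Nonempty (Fin d) := ⟨⟨0, hd⟩⟩
  have hdim : Module.finrank ℝ (EuclideanSpace ℝ (Fin d)) = d := by simp
  calc gaussianIntegral P
      = ∫ y : ({(0)}ᶜ : Set (EuclideanSpace ℝ (Fin d))),
          polyEval P y.1 * Real.exp (-(1 / 2) * ‖y.1‖ ^ 2) 
          ∂((volume : Measure (EuclideanSpace ℝ (Fin d))).comap Subtype.val) := by
        rw [integral_subtype_comap (measurableSet_singleton _).compl
          fun y => polyEval P y * Real.exp (-(1 / 2) * ‖y‖ ^ 2), restrict_compl_singleton]
        rfl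
    _ = ∫ z : Sph d × Set.Ioi (0 : ℝ), polyEval P (z.1 : EuclideanSpace ℝ (Fin d)) *
          (z.2.1 ^ n * Real.exp (-(1 / 2) * z.2.1 ^ 2))
          ∂(sphMeasure d).prod (.volumeIoiPow (d - 1)) := by
        have h := (volume : Measure (EuclideanSpace ℝ (Fin d))).measurePreserving_homeomorphUnitSphereProd.integral_comp
          (Homeomorph.measurableEmbedding _) (fun z : Sph d × Set.Ioi (0 : ℝ) => polyEval P (z.1 : EuclideanSpace ℝ (Fin d)) *
          (z.2.1 ^ n * Real.exp (-(1 / 2) * z.2.1 ^ 2)))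
        rw [hdim] at h
        rw [sphMeasure, ← h]
        refine integral_congr_ae (.of_forall fun y => ?_)
        have hy : ‖y.1‖ ≠ 0 := norm_ne_zero_iff.2 y.2
        simp only [homeomorphUnitSphereProd_apply_fst_coe, homeomorphUnitSphereProd_apply_snd_coe]
        rw [polyEval_smul_of_isHomogeneous hP]
        rw [mul_comm (_ ^ n) (polyEval P _), mul_assoc, ← mul_assoc (_ ^ n), ← mul_pow,
          inv_mul_cancel₀ hy, one_pow, one_mul]
    _ = sphereIntegral P * ∫ r : Set.Ioi (0 : ℝ), r.1 ^ n * Real.exp (-(1 / 2) * r.1 ^ 2)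
          ∂(.volumeIoiPow (d - 1)) :=
        integral_prod_mul (fun x : Sph d => polyEval P (x : EuclideanSpace ℝ (Fin d)))
          (fun r : Set.Ioi (0 : ℝ) => r.1 ^ n * Real.exp (-(1 / 2) * r.1 ^ 2))
    _ = _ := by
        congr 1
        simp only [Measure.volumeIoiPow, ENNReal.ofReal]
        rw [integral_withDensity_eq_integral_smul,
          integral_subtype_comap measurableSet_Ioi fun a : ℝ =>
            Real.toNNReal (a ^ (d - 1)) • (a ^ n * Real.exp (-(1 / 2) * a ^ 2)),
          setIntegral_congr_fun measurableSet_Ioi fun x hx => ?_]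
        · rw [NNReal.smul_def, Real.coe_toNNReal _ (pow_nonneg hx.out.le _), smul_eq_mul,
            Nat.add_sub_assoc hd, pow_add]
          ring
        · exact (measurable_subtype_coe.pow_const _).real_toNNReal

theorem integral_pow_mul_gaussian (m : ℕ) :
    ∫ r in Set.Ioi (0 : ℝ), r ^ m * Real.exp (-(1 / 2) * r ^ 2) =
      (1 / 2 : ℝ) ^ (-((m : ℝ) + 1) / 2) * (1 / 2) * Real.Gamma (((m : ℝ) + 1) / 2) := by
  rw [← integral_rpow_mul_exp_neg_mul_rpow (by norm_num)
    (by have := m.cast_nonneg (α := ℝ); linarith) (by norm_num)]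
  exact integral_congr_ae (.of_forall fun r => by simp [Real.rpow_natCast])

theorem integral_pow_mul_gaussian_pos (m : ℕ) :
    0 < ∫ r in Set.Ioi (0 : ℝ), r ^ m * Real.exp (-(1 / 2) * r ^ 2) := by
  rw [integral_pow_mul_gaussian]
  have := Real.Gamma_pos_of_pos (s := ((m : ℝ) + 1) / 2) (by positivity)
  positivity

theorem integral_pow_add_two_mul_gaussian (m : ℕ) :
    ∫ r in Set.Ioi (0 : ℝ), r ^ (m + 2) * Real.exp (-(1 / 2) * r ^ 2) =
      (m + 1) * ∫ r in Set.Ioi (0 : ℝ), r ^ m * Real.exp (-(1 / 2) * r ^ 2) := by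
  simp only [integral_pow_mul_gaussian]
  push_cast
  rw [show ((m : ℝ) + 2 + 1) / 2 = ((m : ℝ) + 1) / 2 + 1 by ring,
    Real.Gamma_add_one (by positivity),
    show -((m : ℝ) + 2 + 1) / 2 = -((m : ℝ) + 1) / 2 + (-1) by ring,
    Real.rpow_add (by norm_num), Real.rpow_neg_one]
  ring

theorem sphereIntegral_polyLaplacian {d n : ℕ} (hd : 0 < d)
    {P : MvPolynomial (Fin d) ℝ} (hP : P.IsHomogeneous n) :
    sphereIntegral (polyLaplacian d P) = n * (n + d - 2) * sphereIntegral P := by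
  have h := gaussianIntegral_polyLaplacian hP
  rw [gaussianIntegral_eq_mul_sphereIntegral hd hP] at h
  rcases lt_or_ge n 2 with hn | hn
  · rw [polyLaplacian_eq_zero_of_lt_two hP hn] at h ⊢
    have h0 : sphereIntegral (0 : MvPolynomial (Fin d) ℝ) = 0 := by simp [sphereIntegral]
    have h1 : gaussianIntegral (0 : MvPolynomial (Fin d) ℝ) = 0 := by simp [gaussianIntegral]
    rw [h1] at h
    have hc := (integral_pow_mul_gaussian_pos (n + d - 1)).ne'
    rw [h0]
    rcases mul_eq_zero.1 h.symm with h | h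
    · simp [h]
    · rw [(mul_eq_zero.1 h).resolve_right hc, mul_zero]
  · rw [gaussianIntegral_eq_mul_sphereIntegral hd (polyLaplacian_isHomogeneous hP)] at h
    rw [show n + d - 1 = (n - 2 + d - 1) + 2 by omega, integral_pow_add_two_mul_gaussian] at h
    have hc := (integral_pow_mul_gaussian_pos (n - 2 + d - 1)).ne'
    have e : ((n - 2 + d - 1 : ℕ) : ℝ) + 1 = n + d - 2 := by
      rw [show n - 2 + d - 1 = n + d - 3 by omega, Nat.cast_sub (by omega)]
      push_cast; ring
    rw [e] at h
    refine mul_right_cancel₀ hc ?_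
    rw [h]; ring

/-- `lam` is the value by which convolution with the zonal kernel `φ(⟨x, y⟩)` multiplies
spherical harmonics of degree `k`. -/
def IsZonalEigenvalue (d : ℕ) (φ : Polynomial ℝ) (k : ℕ) (lam : ℝ) : Prop :=
  ∀ P : MvPolynomial (Fin d) ℝ, IsSolidHarmonic d k P → ∀ x : Sph d,
    ∫ y : Sph d, φ.eval (inner ℝ (x : EuclideanSpace ℝ (Fin d)) y) * polyEval P y
      ∂(sphMeasure d) = lam * polyEval P x

/-- The linear form `y ↦ ⟨x, y⟩` as a polynomial. -/
def linearPoly {d : ℕ} (x : EuclideanSpace ℝ (Fin d)) : MvPolynomial (Fin d) ℝ :=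
  ∑ i, MvPolynomial.C (x i) * MvPolynomial.X i

/-- The directional derivative of a polynomial. -/
def dirDeriv {d : ℕ} (x : EuclideanSpace ℝ (Fin d)) (P : MvPolynomial (Fin d) ℝ) :
    MvPolynomial (Fin d) ℝ :=
  ∑ i, MvPolynomial.C (x i) * MvPolynomial.pderiv i P

theorem polyEval_linearPoly {d : ℕ} (x y : EuclideanSpace ℝ (Fin d)) :
    polyEval (linearPoly x) y = inner ℝ x y := by
  simp [linearPoly, polyEval_sum, PiLp.inner_apply, mul_comm]

theorem linearPoly_isHomogeneous {d : ℕ} (x : EuclideanSpace ℝ (Fin d)) :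
    (linearPoly x).IsHomogeneous 1 :=
  MvPolynomial.IsHomogeneous.sum _ _ _ fun i _ => by
    simpa using (MvPolynomial.isHomogeneous_C (Fin d) (x i)).mul (MvPolynomial.isHomogeneous_X ℝ i)

theorem pderiv_linearPoly {d : ℕ} (x : EuclideanSpace ℝ (Fin d)) (i : Fin d) :
    MvPolynomial.pderiv i (linearPoly x) = MvPolynomial.C (x i) := by
  classical
  simp [linearPoly, MvPolynomial.pderiv_X, Pi.single_apply]

theorem polyEval_dirDeriv_self {d k : ℕ} (x : EuclideanSpace ℝ (Fin d))
    {P : MvPolynomial (Fin d) ℝ} (hP : P.IsHomogeneous k) :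
    polyEval (dirDeriv x P) x = k * polyEval P x := by
  have h := congrArg (fun Q => polyEval Q x) hP.sum_X_mul_pderiv
  simp only [polyEval_sum, polyEval_mul, polyEval_X] at h
  simp only [dirDeriv, polyEval_sum, polyEval_mul, polyEval_C, h]
  simp [polyEval]

theorem pderiv_pderiv_comm {d : ℕ} (i j : Fin d) (P : MvPolynomial (Fin d) ℝ) :
    MvPolynomial.pderiv i (MvPolynomial.pderiv j P) =
      MvPolynomial.pderiv j (MvPolynomial.pderiv i P) := by
  classical
  let D := fun i : Fin d => (MvPolynomial.pderiv i : Derivation ℝ (MvPolynomial (Fin d) ℝ) _)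
  have h : ⁅D i, D j⁆ = 0 :=
    MvPolynomial.derivation_ext fun k => by
      rw [Derivation.commutator_apply]
      simp only [D, MvPolynomial.pderiv_X, Pi.single_apply]
      split_ifs <;> simp
  have h' := DFunLike.congr_fun h P
  rw [Derivation.commutator_apply] at h'
  exact sub_eq_zero.1 h'

theorem IsSolidHarmonic.dirDeriv {d k : ℕ} {P : MvPolynomial (Fin d) ℝ}
    (hP : IsSolidHarmonic d k P) (x : EuclideanSpace ℝ (Fin d)) :
    IsSolidHarmonic d (k - 1) (dirDeriv x P) := by
  refine ⟨MvPolynomial.IsHomogeneous.sum _ _ _ fun i _ => ?_, ?_⟩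
  · simpa using (MvPolynomial.isHomogeneous_C (Fin d) (x i)).mul (hP.1.pderiv (i := i))
  · have h (i : Fin d) : polyLaplacian d (MvPolynomial.pderiv i P) = 0 := by
      have h0 := congrArg (MvPolynomial.pderiv i) hP.2
      rw [polyLaplacian_apply, map_sum, map_zero] at h0
      rw [polyLaplacian_apply, ← h0]
      refine Finset.sum_congr rfl fun j _ => ?_
      rw [pderiv_pderiv_comm j i P, pderiv_pderiv_comm j i]
    simp only [_root_.dirDeriv, ← MvPolynomial.smul_eq_C_mul, map_sum, map_smul, h, smul_zero,
      Finset.sum_const_zero]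

theorem polyLaplacian_linearPoly_mul {d k : ℕ} {P : MvPolynomial (Fin d) ℝ}
    (hP : IsSolidHarmonic d k P) (x : EuclideanSpace ℝ (Fin d)) :
    polyLaplacian d (linearPoly x * P) = 2 * dirDeriv x P := by
  rw [polyLaplacian_mul, hP.2, polyLaplacian_eq_zero_of_lt_two (linearPoly_isHomogeneous x)
    (by norm_num)]
  simp [pderiv_linearPoly, dirDeriv]

theorem exists_linearPoly_mul_eq {d k : ℕ} (hd : 3 ≤ d) {P : MvPolynomial (Fin d) ℝ}
    (hP : IsSolidHarmonic d k P) (x : EuclideanSpace ℝ (Fin d)) :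
    ∃ H, IsSolidHarmonic d (k + 1) H ∧ linearPoly x * P =
      H + MvPolynomial.C (1 / (2 * k + d - 2) : ℝ) * (normSqPoly d * dirDeriv x P) := by
  have hd' : (3 : ℝ) ≤ d := by exact_mod_cast hd
  have hk : (0 : ℝ) < 2 * k + d - 2 := by have := k.cast_nonneg (α := ℝ); linarith
  refine ⟨_, ⟨?_, ?_⟩, (sub_add_cancel _ _).symm⟩
  · refine MvPolynomial.IsHomogeneous.sub ?_ ?_
    · rw [add_comm]
      exact (linearPoly_isHomogeneous x).mul hP.1
    · rcases k with _ | k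
      · have : dirDeriv x P = 0 := by
          obtain h := (MvPolynomial.totalDegree_eq_zero_iff_eq_C.1
            (Nat.le_zero.1 hP.1.totalDegree_le))
          rw [h]; simp [dirDeriv]
        rw [this, mul_zero, mul_zero]
        exact MvPolynomial.isHomogeneous_zero _ _ _
      · have := (MvPolynomial.isHomogeneous_C (Fin d) (1 / (2 * (k + 1 : ℕ) + d - 2) : ℝ)).mul
          ((normSqPoly_isHomogeneous d).mul (hP.dirDeriv x).1)
        rwa [show 0 + (2 + (k + 1 - 1)) = k + 1 + 1 by omega] at this
  · have h2 : (2 : MvPolynomial (Fin d) ℝ) = MvPolynomial.C 2 := (map_ofNat MvPolynomial.C 2).symm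
    rw [map_sub, polyLaplacian_linearPoly_mul hP, ← MvPolynomial.smul_eq_C_mul, map_smul,
      polyLaplacian_normSqPoly_mul (hP.dirDeriv x).1, (hP.dirDeriv x).2, mul_zero, add_zero,
      h2, MvPolynomial.smul_eq_C_mul, ← mul_assoc, ← MvPolynomial.C_mul]
    rcases k with _ | k
    · have : dirDeriv x P = 0 := by
        obtain h := (MvPolynomial.totalDegree_eq_zero_iff_eq_C.1
          (Nat.le_zero.1 hP.1.totalDegree_le))
        rw [h]; simp [dirDeriv]
      rw [this, mul_zero, mul_zero, sub_zero]
    · have : (1 / (2 * (k + 1 : ℕ) + d - 2) : ℝ) * (2 * d + 4 * (k + 1 - 1 : ℕ)) = 2 := by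
        rw [Nat.add_sub_cancel]
        push_cast at hk ⊢
        field_simp
        ring
      rw [this, sub_self]

theorem integrable_sphere_of_continuous {d : ℕ} {f : Sph d → ℝ} (hf : Continuous f) :
    Integrable f (sphMeasure d) :=
  hf.integrable_of_hasCompactSupport (HasCompactSupport.of_compactSpace f)

theorem integrable_zonal_mul {d : ℕ} (φ : Polynomial ℝ) (x : EuclideanSpace ℝ (Fin d))
    (P : MvPolynomial (Fin d) ℝ) :
    Integrable (fun y : Sph d => φ.eval (inner ℝ x (y : EuclideanSpace ℝ (Fin d))) *
      polyEval P y) (sphMeasure d) :=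
  integrable_sphere_of_continuous <| (φ.continuous.comp (by fun_prop)).mul
    ((continuous_polyEval P).comp continuous_subtype_val)

theorem sphereIntegral_eq_zero {d k : ℕ} (hd : 3 ≤ d) (hk : 1 ≤ k) {P : MvPolynomial (Fin d) ℝ}
    (hP : IsSolidHarmonic d k P) : sphereIntegral P = 0 := by
  have h := sphereIntegral_polyLaplacian (by omega) hP.1
  rw [hP.2] at h
  have h0 : sphereIntegral (0 : MvPolynomial (Fin d) ℝ) = 0 := by simp [sphereIntegral]
  rw [h0] at h
  have hd' : (3 : ℝ) ≤ d := by exact_mod_cast hd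
  have hk' : (1 : ℝ) ≤ k := by exact_mod_cast hk
  have : (k : ℝ) * (k + d - 2) ≠ 0 := by
    apply ne_of_gt; apply mul_pos <;> linarith
  exact (mul_eq_zero.1 h.symm).resolve_left this

theorem isZonalEigenvalue_one_zero (d : ℕ) :
    IsZonalEigenvalue d 1 0 ((sphMeasure d).real Set.univ) := by
  intro P hP x
  have h := MvPolynomial.totalDegree_eq_zero_iff_eq_C.1 (Nat.le_zero.1 hP.1.totalDegree_le)
  rw [h]
  simp

theorem isZonalEigenvalue_one_of_pos {d k : ℕ} (hd : 3 ≤ d) (hk : 1 ≤ k) :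
    IsZonalEigenvalue d 1 k 0 := by
  intro P hP x
  simpa [sphereIntegral] using sphereIntegral_eq_zero hd hk hP

theorem IsZonalEigenvalue.X_mul {d k : ℕ} (hd : 3 ≤ d) {φ : Polynomial ℝ} {a b : ℝ}
    (ha : IsZonalEigenvalue d φ (k + 1) a) (hb : 1 ≤ k → IsZonalEigenvalue d φ (k - 1) b) :
    IsZonalEigenvalue d (Polynomial.X * φ) k
      (((k + d - 2) * a + k * b) / (2 * k + d - 2)) := by
  have hd' : (3 : ℝ) ≤ d := by exact_mod_cast hd
  have hk : (0 : ℝ) < 2 * k + d - 2 := by have := k.cast_nonneg (α := ℝ); linarith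
  intro P hP x
  obtain ⟨H, hH, hHP⟩ := exists_linearPoly_mul_eq hd hP (x : EuclideanSpace ℝ (Fin d))
  have e (y : Sph d) : inner ℝ (x : EuclideanSpace ℝ (Fin d)) y * polyEval P y =
      polyEval H y + 1 / (2 * k + d - 2) * polyEval (dirDeriv (x : EuclideanSpace ℝ (Fin d)) P) y := by
    have := congrArg (fun Q => polyEval Q (y : EuclideanSpace ℝ (Fin d))) hHP
    simpa [polyEval_linearPoly, polyEval_normSqPoly] using this
  have hD : ∫ y : Sph d, φ.eval (inner ℝ (x : EuclideanSpace ℝ (Fin d)) y) *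
      polyEval (dirDeriv (x : EuclideanSpace ℝ (Fin d)) P) y ∂(sphMeasure d) =
      k * b * polyEval P x := by
    rcases k with _ | k
    · have : dirDeriv (x : EuclideanSpace ℝ (Fin d)) P = 0 := by
        rw [MvPolynomial.totalDegree_eq_zero_iff_eq_C.1 (Nat.le_zero.1 hP.1.totalDegree_le)]
        simp [dirDeriv]
      simp [this]
    · rw [hb (by omega) _ (hP.dirDeriv x) x, polyEval_dirDeriv_self _ hP.1]
      ring
  have hx : polyEval H (x : EuclideanSpace ℝ (Fin d)) =
      (1 - 1 / (2 * k + d - 2) * k) * polyEval P x := by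
    have := e x
    rw [polyEval_dirDeriv_self _ hP.1] at this
    simp at this
    simp
    linarith
  calc ∫ y : Sph d, (Polynomial.X * φ).eval (inner ℝ (x : EuclideanSpace ℝ (Fin d)) y) *
        polyEval P y ∂(sphMeasure d)
      = ∫ y : Sph d, (φ.eval (inner ℝ (x : EuclideanSpace ℝ (Fin d)) y) * polyEval H y +
          1 / (2 * k + d - 2) * (φ.eval (inner ℝ (x : EuclideanSpace ℝ (Fin d)) y) *
          polyEval (dirDeriv (x : EuclideanSpace ℝ (Fin d)) P) y)) ∂(sphMeasure d) := by
        refine integral_congr_ae (.of_forall fun y => ?_)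
        simp only [Polynomial.eval_mul, Polynomial.eval_X]
        linear_combination (φ.eval (inner ℝ (x : EuclideanSpace ℝ (Fin d)) y)) * e y
    _ = _ := by
        rw [integral_add (integrable_zonal_mul _ _ _) ((integrable_zonal_mul _ _ _).const_mul _),
          integral_const_mul, ha H hH x, hD, hx]
        field_simp
        ring

theorem IsZonalEigenvalue.two_mul_sub {d k : ℕ} {φ ψ : Polynomial ℝ} {a b : ℝ}
    (ha : IsZonalEigenvalue d φ k a) (hb : IsZonalEigenvalue d ψ k b) :
    IsZonalEigenvalue d (2 * φ - ψ) k (2 * a - b) := by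
  intro P hP x
  rw [sub_mul, mul_assoc, ← ha P hP x, ← hb P hP x, ← integral_const_mul, ← integral_sub
    ((integrable_zonal_mul _ _ _).const_mul _) (integrable_zonal_mul _ _ _)]
  refine integral_congr_ae (.of_forall fun y => ?_)
  simp
  ring

/-- The product `∏_{j < l} (j - ν) / (j + 1)`. -/
def risingRatio (ν : ℝ) (l : ℕ) : ℝ := ∏ j ∈ Finset.range l, ((j : ℝ) - ν) / (j + 1)

/-- The quotient `m! Γ(ν + 1) / Γ(m + ν + 1)`. -/
def gammaRatio (ν : ℝ) (m : ℕ) : ℝ := ∏ j ∈ Finset.range m, ((j : ℝ) + 1) / (j + 1 + ν)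

theorem risingRatio_succ (ν : ℝ) (l : ℕ) :
    risingRatio ν (l + 1) = risingRatio ν l * ((l - ν) / (l + 1)) :=
  Finset.prod_range_succ _ _

theorem gammaRatio_succ (ν : ℝ) (m : ℕ) :
    gammaRatio ν (m + 1) = gammaRatio ν m * ((m + 1) / (m + 1 + ν)) :=
  Finset.prod_range_succ _ _

theorem gammaRatio_pos {ν : ℝ} (hν : 0 ≤ ν) (m : ℕ) : 0 < gammaRatio ν m :=
  Finset.prod_pos fun j _ => by positivity

/-- The eigenvalue of the Chebyshev kernel of degree `k + 2 l` on harmonics of degree `k`. -/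
def chebEigenvalue (d k l : ℕ) : ℝ :=
  (sphMeasure d).real Set.univ / 2 * ((k + 2 * l : ℝ) / (k + l)) *
    risingRatio ((d : ℝ) / 2 - 1) l * gammaRatio ((d : ℝ) / 2 - 1) (k + l)

/-- The kernel `φ` has the eigenvalues of the Chebyshev kernel of degree `n`. -/
def HasChebEigenvalues (d n : ℕ) (φ : Polynomial ℝ) : Prop :=
  (∀ k l, k + 2 * l = n → IsZonalEigenvalue d φ k (chebEigenvalue d k l)) ∧
    ∀ k, (∀ l, k + 2 * l ≠ n) → IsZonalEigenvalue d φ k 0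

theorem chebEigenvalue_recurrence_zero {d : ℕ} (hd : 3 ≤ d) {n : ℕ} (hn : 1 ≤ n) :
    2 * (((n + 1 : ℕ) + d - 2) * 0 + (n + 1 : ℕ) * chebEigenvalue d n 0) /
      (2 * (n + 1 : ℕ) + d - 2) = chebEigenvalue d (n + 1) 0 := by
  have hd' : (3 : ℝ) ≤ d := by exact_mod_cast hd
  have hn' : (1 : ℝ) ≤ n := by exact_mod_cast hn
  have h1 : (0 : ℝ) < 2 * (n + 1) + d - 2 := by linarith
  have h2 : (0 : ℝ) < n + 1 + (d / 2 - 1) := by linarith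
  simp only [chebEigenvalue, add_zero, gammaRatio_succ]
  push_cast
  generalize gammaRatio ((d : ℝ) / 2 - 1) n = w
  simp only [mul_zero, add_zero, zero_add]
  have h3 : 2 * ((n : ℝ) + 1) + d - 2 = 2 * (n + 1 + (d / 2 - 1)) := by ring
  rw [h3, div_self (by linarith), div_self (by linarith)]
  field_simp

theorem chebEigenvalue_recurrence {d : ℕ} (hd : 3 ≤ d) {k l : ℕ} (hkl : 1 ≤ k + l) :
    2 * (((k + d - 2) * chebEigenvalue d (k + 1) l + k * chebEigenvalue d (k - 1) (l + 1)) /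
      (2 * k + d - 2)) - chebEigenvalue d k l = chebEigenvalue d k (l + 1) := by
  have hd' : (3 : ℝ) ≤ d := by exact_mod_cast hd
  obtain ⟨ν, hν⟩ : ∃ ν : ℝ, ν = d / 2 - 1 := ⟨_, rfl⟩
  have hdν : (d : ℝ) = 2 * ν + 2 := by linarith
  have hν0 : 0 < ν := by linarith
  have hm : (0 : ℝ) < k + l := by exact_mod_cast hkl
  have hl : (0 : ℝ) ≤ l := l.cast_nonneg
  have hk : (0 : ℝ) ≤ k := k.cast_nonneg
  have e2 : ((k : ℝ) * ((sphMeasure d).real Set.univ / 2 * (((k - 1 : ℕ) + 2 * (l + 1 : ℕ) : ℝ) / ((k - 1 : ℕ) + (l + 1 : ℕ))) *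
      risingRatio ν (l + 1) * gammaRatio ν (k - 1 + (l + 1)))) =
      k * ((sphMeasure d).real Set.univ / 2 * ((k + 2 * l + 1) / (k + l)) *
      (risingRatio ν l * ((l - ν) / (l + 1))) * gammaRatio ν (k + l)) := by
    rcases k with _ | k
    · simp
    · rw [Nat.add_sub_cancel, risingRatio_succ, show k + (l + 1) = k + 1 + l by ring]
      push_cast
      rw [show (k : ℝ) + (l + 1) = k + 1 + l by ring,
        show (k : ℝ) + 2 * (l + 1) = k + 1 + 2 * l + 1 by ring]
  simp only [chebEigenvalue, ← hν]
  rw [e2, show k + 1 + l = k + l + 1 by ring, show k + (l + 1) = k + l + 1 by ring,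
    gammaRatio_succ, risingRatio_succ, hdν]
  push_cast
  have h1 : (k : ℝ) + 1 + l ≠ 0 := by positivity
  have h2 : (k : ℝ) + l + 1 + ν ≠ 0 := by positivity
  have h3 : (2 * (k : ℝ) + (2 * ν + 2) - 2) ≠ 0 := by
    rw [show (2 * (k : ℝ) + (2 * ν + 2) - 2) = 2 * (k + ν) by ring]; positivity
  have h4 : (k : ℝ) + (l + 1) ≠ 0 := by positivity
  have h5 : (k : ℝ) + l + 1 ≠ 0 := by positivity
  generalize gammaRatio ν (k + l) = w
  generalize risingRatio ν l = r
  rw [show (k : ℝ) + 1 + l = k + l + 1 by ring, show (k : ℝ) + (l + 1) = k + l + 1 by ring,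
    show (2 * (k : ℝ) + (2 * ν + 2) - 2) = 2 * (k + ν) by ring]
  have h6 : (k : ℝ) + ν ≠ 0 := by positivity
  field_simp
  ring

theorem HasChebEigenvalues.step {d n : ℕ} (hd : 3 ≤ d) (hn : 1 ≤ n) {φ ψ : Polynomial ℝ}
    (hφ : HasChebEigenvalues d n φ) (hψ : HasChebEigenvalues d (n - 1) ψ ∧ 2 ≤ n ∨ ψ = 1 ∧ n = 1) :
    HasChebEigenvalues d (n + 1) (2 * (Polynomial.X * φ) - ψ) := by
  have hψ0 (k : ℕ) (hk : ∀ l, k + 2 * l + 1 ≠ n) : IsZonalEigenvalue d ψ k 0 := by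
    rcases hψ with ⟨h, h2⟩ | ⟨rfl, rfl⟩
    · exact h.2 k fun l hl => hk l (by omega)
    · exact isZonalEigenvalue_one_of_pos hd (by have := hk 0; omega)
  refine ⟨fun k l hkl => ?_, fun k hk => ?_⟩
  · rcases l with _ | l
    · obtain rfl : k = n + 1 := by omega
      have h := (IsZonalEigenvalue.X_mul hd (hφ.2 (n + 1 + 1) (by omega))
        fun _ => hφ.1 (n + 1 - 1) 0 (by omega)).two_mul_sub (hψ0 (n + 1) (by omega))
      rwa [sub_zero, Nat.add_sub_cancel, ← mul_div_assoc,
        chebEigenvalue_recurrence_zero hd hn] at h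
    · have h0 := IsZonalEigenvalue.X_mul hd (hφ.1 (k + 1) l (by omega))
        fun _ => hφ.1 (k - 1) (l + 1) (by omega)
      rcases hψ with ⟨h, h2⟩ | ⟨rfl, rfl⟩
      · rw [← chebEigenvalue_recurrence hd (by omega)]
        exact h0.two_mul_sub (h.1 k l (by omega))
      · obtain ⟨rfl, rfl⟩ : k = 0 ∧ l = 0 := by omega
        convert h0.two_mul_sub (isZonalEigenvalue_one_zero d) using 1
        have hd' : (3 : ℝ) ≤ d := by exact_mod_cast hd
        have h1 : (d : ℝ) - 2 ≠ 0 := by linarith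
        have h2 : 1 + ((d : ℝ) / 2 - 1) ≠ 0 := by linarith
        simp [chebEigenvalue, risingRatio, gammaRatio]
        field_simp
  · rw [show (0 : ℝ) = 2 * (((k + d - 2) * 0 + k * 0) / (2 * k + d - 2)) - 0 by simp]
    refine (IsZonalEigenvalue.X_mul hd (hφ.2 _ fun l hl => hk (l + 1) (by omega))
      fun h1 => hφ.2 _ fun l hl => hk l (by omega)).two_mul_sub
      (hψ0 k fun l hl => hk (l + 1) (by omega))

theorem hasChebEigenvalues_X {d : ℕ} (hd : 3 ≤ d) : HasChebEigenvalues d 1 Polynomial.X := by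
  rw [← mul_one Polynomial.X]
  have hd' : (3 : ℝ) ≤ d := by exact_mod_cast hd
  refine ⟨fun k l hkl => ?_, fun k hk => ?_⟩
  · obtain ⟨rfl, rfl⟩ : k = 1 ∧ l = 0 := by omega
    convert IsZonalEigenvalue.X_mul (k := 1) hd (isZonalEigenvalue_one_of_pos hd (by norm_num))
      fun _ => isZonalEigenvalue_one_zero d using 1
    have h1 : 1 + ((d : ℝ) / 2 - 1) ≠ 0 := by linarith
    have h2 : 2 + (d : ℝ) - 2 ≠ 0 := by linarith
    simp [chebEigenvalue, risingRatio, gammaRatio]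
    field_simp
  · rw [show (0 : ℝ) = ((k + d - 2) * 0 + k * 0) / (2 * k + d - 2) by simp]
    exact IsZonalEigenvalue.X_mul hd (isZonalEigenvalue_one_of_pos hd (by omega)) fun h1 =>
      isZonalEigenvalue_one_of_pos hd (by have := hk 0; omega)

theorem hasChebEigenvalues_chebyshev {d : ℕ} (hd : 3 ≤ d) {n : ℕ} (hn : 1 ≤ n) :
    HasChebEigenvalues d n (Polynomial.Chebyshev.T ℝ n) := by
  induction n using Nat.strong_induction_on with
  | _ n ih =>
    obtain rfl | ⟨m, rfl⟩ : n = 1 ∨ ∃ m, n = m + 2 := by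
      rcases n with _ | _ | n
      · omega
      · simp
      · exact .inr ⟨n, rfl⟩
    · simpa using hasChebEigenvalues_X hd
    · have h := Polynomial.Chebyshev.T_add_two ℝ m
      push_cast
      rw [h, mul_assoc]
      have h1 := ih (m + 1) (by omega) (by omega)
      push_cast at h1
      refine HasChebEigenvalues.step hd (by omega) h1 ?_
      rcases Nat.eq_zero_or_pos m with rfl | hm
      · simp
      · exact .inl ⟨ih m (by omega) hm, by omega⟩

theorem sphMeasure_real_univ_pos {d : ℕ} (hd : 0 < d) : 0 < (sphMeasure d).real Set.univ := by
  have : Nonempty (Fin d) := ⟨⟨0, hd⟩⟩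
  rw [Measure.real, ENNReal.toReal_pos_iff]
  refine ⟨?_, measure_lt_top _ _⟩
  rw [Measure.measure_univ_pos, sphMeasure]
  exact Measure.toSphere_ne_zero _

theorem exists_isZonalEigenvalue_ne_zero {d : ℕ} (hd : 3 ≤ d) (k : ℕ) :
    ∃ (φ : Polynomial ℝ) (lam : ℝ), lam ≠ 0 ∧ IsZonalEigenvalue d φ k lam ∧
      ∀ l, k < l → IsZonalEigenvalue d φ l 0 := by
  have hd' : (3 : ℝ) ≤ d := by exact_mod_cast hd
  have hS := (sphMeasure_real_univ_pos (d := d) (by omega)).ne'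
  rcases Nat.eq_zero_or_pos k with rfl | hk
  · exact ⟨1, _, hS, isZonalEigenvalue_one_zero d, fun l hl => isZonalEigenvalue_one_of_pos hd hl⟩
  · have h := hasChebEigenvalues_chebyshev hd hk
    refine ⟨_, _, ?_, h.1 k 0 rfl, fun l hl => h.2 l (by omega)⟩
    have hk' : (k : ℝ) ≠ 0 := by positivity
    simp [chebEigenvalue, risingRatio, hS, hk', (gammaRatio_pos (ν := (d : ℝ) / 2 - 1) (by linarith) k).ne']

theorem exists_abs_risingRatio_le {ν : ℝ} (hν : 0 ≤ ν) :
    ∃ C, ∀ l, |risingRatio ν l| ≤ C := by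
  obtain ⟨N, hN⟩ := exists_nat_ge ν
  refine ⟨∑ i ∈ Finset.range (N + 1), |risingRatio ν i|, fun l => ?_⟩
  rcases Nat.lt_or_ge l (N + 1) with hl | hl
  · exact Finset.single_le_sum (f := fun i => |risingRatio ν i|) (fun i _ => abs_nonneg _)
      (Finset.mem_range.2 hl)
  induction l, hl using Nat.le_induction with
  | base =>
    rw [risingRatio_succ, abs_mul]
    refine (mul_le_of_le_one_right (abs_nonneg _) ?_).trans
      (Finset.single_le_sum (f := fun i => |risingRatio ν i|) (fun i _ => abs_nonneg _)
        (Finset.self_mem_range_succ N))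
    rw [abs_div, abs_of_nonneg (by linarith), abs_of_pos (by positivity), div_le_one (by positivity)]
    linarith
  | succ l hl ih =>
    have : ν ≤ l := hN.trans (by exact_mod_cast (by omega))
    rw [risingRatio_succ, abs_mul]
    refine (mul_le_of_le_one_right (abs_nonneg _) ?_).trans ih
    rw [abs_div, abs_of_nonneg (by linarith), abs_of_pos (by positivity), div_le_one (by positivity)]
    linarith

theorem gammaRatio_mul_rpow {ν : ℝ} (hν : 0 < ν) {m : ℕ} (hm : 1 ≤ m) :
    gammaRatio ν m * (m : ℝ) ^ ν = ν * Real.GammaSeq ν m := by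
  have h (m : ℕ) : gammaRatio ν m * ∏ j ∈ Finset.range (m + 1), (ν + j) = ν * m.factorial := by
    induction m with
    | zero => simp [gammaRatio]
    | succ m ih =>
      rw [Finset.prod_range_succ, gammaRatio_succ, Nat.factorial_succ]
      have : (m : ℝ) + 1 + ν ≠ 0 := by positivity
      push_cast
      field_simp
      linear_combination (m + 1 + ν) * ih
  have hp : ∏ j ∈ Finset.range (m + 1), (ν + j) ≠ 0 :=
    (Finset.prod_pos fun j _ => by positivity).ne'
  rw [Real.GammaSeq]
  field_simp
  linear_combination h m

theorem exists_gammaRatio_bounds {ν : ℝ} (hν : 0 < ν) : ∃ c C : ℝ, 0 < c ∧ 0 < C ∧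
    ∀ m : ℕ, 1 ≤ m → c * (m : ℝ) ^ (-ν) ≤ gammaRatio ν m ∧
      gammaRatio ν m ≤ C * (m : ℝ) ^ (-ν) := by
  have ht : Filter.Tendsto (fun m : ℕ => ν * Real.GammaSeq ν (m + 1)) Filter.atTop
      (nhds (ν * Real.Gamma ν)) :=
    ((Real.GammaSeq_tendsto_Gamma ν).comp (Filter.tendsto_add_atTop_nat 1)).const_mul ν
  have hpos : 0 < ν * Real.Gamma ν := mul_pos hν (Real.Gamma_pos_of_pos hν)
  have hti := ht.inv₀ hpos.ne'
  obtain ⟨C, hC⟩ := ht.bddAbove_range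
  obtain ⟨D, hD⟩ := hti.bddAbove_range
  have hC' (m : ℕ) := hC (Set.mem_range_self m)
  have hD' (m : ℕ) := hD (Set.mem_range_self m)
  have hseq (m : ℕ) : 0 < ν * Real.GammaSeq ν (m + 1) := by
    rw [← gammaRatio_mul_rpow hν (by omega)]
    have := gammaRatio_pos hν.le (m + 1)
    positivity
  have hCpos : 0 < C := (hseq 0).trans_le (hC' 0)
  have hDpos : 0 < D := (inv_pos.2 (hseq 0)).trans_le (hD' 0)
  refine ⟨D⁻¹, C, inv_pos.2 hDpos, hCpos, fun m hm => ?_⟩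
  obtain ⟨m, rfl⟩ : ∃ i, m = i + 1 := ⟨m - 1, by omega⟩
  have hx : (0 : ℝ) < ((m + 1 : ℕ) : ℝ) ^ ν := by positivity
  rw [Real.rpow_neg (by positivity)]
  have e := gammaRatio_mul_rpow hν hm
  rw [← div_eq_mul_inv, ← div_eq_mul_inv, div_le_iff₀ hx, le_div_iff₀ hx, e]
  exact ⟨inv_le_of_inv_le₀ (hseq m) (hD' m), hC' m⟩

theorem exists_chebEigenvalue_bounds {d : ℕ} (hd : 3 ≤ d) :
    ∃ C : ℝ, 0 < C ∧ ∀ n : ℕ, 1 ≤ n → ∃ mu : ℝ, 0 < mu ∧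
      mu⁻¹ ≤ C * (n : ℝ) ^ ((d : ℝ) / 2 - 1) ∧
      IsZonalEigenvalue d (Polynomial.Chebyshev.T ℝ n) n mu ∧
      ∀ k, ∃ lam, |lam| ≤ C * mu ∧ IsZonalEigenvalue d (Polynomial.Chebyshev.T ℝ n) k lam := by
  have hd' : (3 : ℝ) ≤ d := by exact_mod_cast hd
  have hν : 0 < (d : ℝ) / 2 - 1 := by linarith
  obtain ⟨a, b, ha, hb, hab⟩ := exists_gammaRatio_bounds hν
  obtain ⟨R, hR⟩ := exists_abs_risingRatio_le hν.le
  have hS := sphMeasure_real_univ_pos (d := d) (by omega)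
  have hR0 : 0 ≤ R := (abs_nonneg _).trans (hR 0)
  set S := (sphMeasure d).real Set.univ with hSdef
  set ν := (d : ℝ) / 2 - 1 with hνdef
  refine ⟨2 / (S * a) + 2 * R * (b * 2 ^ ν / a), by positivity, fun n hn => ?_⟩
  have hn0 : (0 : ℝ) < n := by exact_mod_cast hn
  have hw := gammaRatio_pos hν.le n
  have hE := hasChebEigenvalues_chebyshev hd hn
  have hmu : chebEigenvalue d n 0 = S / 2 * gammaRatio ν n := by
    simp [chebEigenvalue, risingRatio, ← hSdef, ← hνdef, hn0.ne']
  refine ⟨S / 2 * gammaRatio ν n, by positivity, ?_, hmu ▸ hE.1 n 0 rfl, fun k => ?_⟩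
  · have h1 : (S / 2 * gammaRatio ν n)⁻¹ ≤ (S / 2 * (a * (n : ℝ) ^ (-ν)))⁻¹ := by
      gcongr
      exact (hab n hn).1
    refine h1.trans ?_
    rw [Real.rpow_neg hn0.le]
    have : (S / 2 * (a * ((n : ℝ) ^ ν)⁻¹))⁻¹ = 2 / (S * a) * (n : ℝ) ^ ν := by
      field_simp
    rw [this]
    gcongr
    exact le_add_of_nonneg_right (by positivity)
  · by_cases hk : ∃ l, k + 2 * l = n
    · obtain ⟨l, hl⟩ := hk
      refine ⟨_, ?_, hE.1 k l hl⟩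
      have hkl : 1 ≤ k + l := by omega
      have hkl0 : (0 : ℝ) < k + l := by exact_mod_cast hkl
      have h1 : ((k : ℝ) + 2 * l) / (k + l) ≤ 2 := by
        rw [div_le_iff₀ hkl0]
        linarith [k.cast_nonneg (α := ℝ)]
      have h2 : gammaRatio ν (k + l) ≤ b * 2 ^ ν / a * gammaRatio ν n := by
        calc gammaRatio ν (k + l) ≤ b * ((k + l : ℕ) : ℝ) ^ (-ν) := (hab _ hkl).2
          _ ≤ b * ((n : ℝ) / 2) ^ (-ν) := by
            gcongr b * ?_
            refine Real.rpow_le_rpow_of_nonpos (by positivity) ?_ (by linarith)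
            have : (n : ℝ) = k + 2 * l := by rw [← hl]; push_cast; ring
            rw [this]; push_cast
            linarith [k.cast_nonneg (α := ℝ)]
          _ = b * 2 ^ ν / a * (a * (n : ℝ) ^ (-ν)) := by
            rw [Real.div_rpow hn0.le (by norm_num), Real.rpow_neg (x := 2) (by norm_num)]
            field_simp
          _ ≤ _ := by
            gcongr
            exact (hab n hn).1
      rw [chebEigenvalue, ← hSdef, ← hνdef, abs_mul, abs_mul, abs_mul, abs_of_pos (by positivity : 0 < S / 2),
        abs_of_nonneg (by positivity : (0 : ℝ) ≤ ((k : ℝ) + 2 * l) / (k + l)),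
        abs_of_pos (gammaRatio_pos hν.le (k + l))]
      calc S / 2 * (((k : ℝ) + 2 * l) / (k + l)) * |risingRatio ν l| * gammaRatio ν (k + l)
          ≤ S / 2 * 2 * R * (b * 2 ^ ν / a * gammaRatio ν n) := by
            gcongr
            · exact (gammaRatio_pos hν.le _).le
            · exact hR l
        _ = 2 * R * (b * 2 ^ ν / a) * (S / 2 * gammaRatio ν n) := by ring
        _ ≤ _ := by
          gcongr
          exact le_add_of_nonneg_left (by positivity)
    · refine ⟨0, ?_, hE.2 k fun l hl => hk ⟨l, hl⟩⟩
      rw [abs_zero]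
      positivity

/-- Convolution of a function on the sphere with the zonal kernel `φ(⟨x, y⟩)`. -/
def zonalConv {d : ℕ} (φ : Polynomial ℝ) (f : Sph d → ℝ) (x : Sph d) : ℝ :=
  ∫ y : Sph d, φ.eval (inner ℝ (x : EuclideanSpace ℝ (Fin d)) y) * f y ∂(sphMeasure d)

/-- The space of spherical harmonics of degree `k`. -/
def sphHarmonics (d k : ℕ) : Submodule ℝ (Sph d → ℝ) where
  carrier := {Y | ∃ P, IsSolidHarmonic d k P ∧ ∀ x : Sph d, Y x = polyEval P x}
  zero_mem' := ⟨0, ⟨MvPolynomial.isHomogeneous_zero _ _ _, map_zero _⟩, fun x => by simp⟩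
  add_mem' := by
    rintro Y Z ⟨P, hP, hY⟩ ⟨Q, hQ, hZ⟩
    exact ⟨P + Q, ⟨hP.1.add hQ.1, by rw [map_add, hP.2, hQ.2, add_zero]⟩,
      fun x => by simp [hY, hZ]⟩
  smul_mem' := by
    rintro c Y ⟨P, hP, hY⟩
    refine ⟨MvPolynomial.C c * P, ⟨?_, ?_⟩, fun x => by simp [hY]⟩
    · simpa using (MvPolynomial.isHomogeneous_C (Fin d) c).mul hP.1
    · rw [← MvPolynomial.smul_eq_C_mul, map_smul, hP.2, smul_zero]

theorem continuous_of_mem_sphHarmonics {d k : ℕ} {Y : Sph d → ℝ} (hY : Y ∈ sphHarmonics d k) :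
    Continuous Y := by
  obtain ⟨P, -, h⟩ := hY
  rw [funext h]
  exact (continuous_polyEval P).comp continuous_subtype_val

theorem IsZonalEigenvalue.zonalConv_eq {d k : ℕ} {φ : Polynomial ℝ} {lam : ℝ}
    (h : IsZonalEigenvalue d φ k lam) {Y : Sph d → ℝ} (hY : Y ∈ sphHarmonics d k) :
    zonalConv φ Y = lam • Y := by
  obtain ⟨P, hP, hYP⟩ := hY
  ext x
  simp only [zonalConv, hYP, Pi.smul_apply, smul_eq_mul]
  exact h P hP x

theorem polyEval_mem_iSup_sphHarmonics {d : ℕ} (hd : 0 < d) (P : MvPolynomial (Fin d) ℝ) :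
    (fun x : Sph d => polyEval P x) ∈ ⨆ k, sphHarmonics d k := by
  let R : MvPolynomial (Fin d) ℝ →ₗ[ℝ] (Sph d → ℝ) :=
    { toFun := fun P x => polyEval P x
      map_add' := fun P Q => by ext; simp
      map_smul' := fun c P => by ext; simp [MvPolynomial.smul_eq_C_mul] }
  have h (q : ℕ) : harmonicSpan d q ≤ (⨆ k, sphHarmonics d k).comap R := by
    refine Submodule.span_le.2 ?_
    rintro _ ⟨j, k, H, -, hH, rfl⟩
    refine Submodule.mem_iSup_of_mem k ⟨H, hH, fun x => ?_⟩
    simp [R, polyEval_normSqPoly]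
  change P ∈ (⨆ k, sphHarmonics d k).comap R
  rw [← P.sum_homogeneousComponent]
  exact Submodule.sum_mem _ fun q _ =>
    h q (mem_harmonicSpan hd q _ (MvPolynomial.homogeneousComponent_isHomogeneous q P))

theorem exists_abs_eval_inner_le {d : ℕ} (φ : Polynomial ℝ) :
    ∃ M, ∀ z : Sph d × Sph d, ‖φ.eval (inner ℝ (z.1 : EuclideanSpace ℝ (Fin d)) z.2)‖ ≤ M := by
  have hc : Continuous fun z : Sph d × Sph d =>
      φ.eval (inner ℝ (z.1 : EuclideanSpace ℝ (Fin d)) z.2) := φ.continuous.comp (by fun_prop)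
  obtain ⟨M, hM⟩ := (isCompact_univ.image hc).isBounded.exists_norm_le
  exact ⟨M, fun z => hM _ ⟨z, trivial, rfl⟩⟩

theorem integrable_zonal_mul_of_integrable {d : ℕ} (φ : Polynomial ℝ) {f : Sph d → ℝ}
    (hf : Integrable f (sphMeasure d)) (x : Sph d) :
    Integrable (fun y : Sph d => φ.eval (inner ℝ (x : EuclideanSpace ℝ (Fin d)) y) * f y)
      (sphMeasure d) := by
  obtain ⟨M, hM⟩ := exists_abs_eval_inner_le (d := d) φ
  exact hf.bdd_mul (φ.continuous.comp (by fun_prop)).aestronglyMeasurable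
    (.of_forall fun y => hM (x, y))

theorem integral_zonalConv_mul {d : ℕ} (φ : Polynomial ℝ) {f g : Sph d → ℝ}
    (hf : Integrable f (sphMeasure d)) (hg : Integrable g (sphMeasure d)) :
    ∫ x, zonalConv φ f x * g x ∂(sphMeasure d) = ∫ x, f x * zonalConv φ g x ∂(sphMeasure d) := by
  obtain ⟨M, hM⟩ := exists_abs_eval_inner_le (d := d) φ
  have hint : Integrable (fun z : Sph d × Sph d =>
      φ.eval (inner ℝ (z.1 : EuclideanSpace ℝ (Fin d)) z.2) * (g z.1 * f z.2))
      ((sphMeasure d).prod (sphMeasure d)) :=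
    (hg.mul_prod hf).bdd_mul (φ.continuous.comp (by fun_prop)).aestronglyMeasurable
      (.of_forall hM)
  have h := integral_integral_swap (f := fun x y : Sph d =>
    φ.eval (inner ℝ (x : EuclideanSpace ℝ (Fin d)) y) * (g x * f y)) hint
  calc _ = ∫ x : Sph d, ∫ y : Sph d, φ.eval (inner ℝ (x : EuclideanSpace ℝ (Fin d)) y) *
        (g x * f y) ∂(sphMeasure d) ∂(sphMeasure d) := by
        refine integral_congr_ae (.of_forall fun x => ?_)
        simp only [zonalConv]
        rw [← integral_mul_const]
        exact integral_congr_ae (.of_forall fun y => by ring)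
    _ = _ := by
        rw [h]
        refine integral_congr_ae (.of_forall fun y => ?_)
        simp only [zonalConv]
        rw [← integral_const_mul]
        refine integral_congr_ae (.of_forall fun x => ?_)
        simp only [real_inner_comm]
        ring

theorem integral_mul_eq_zero_of_lt {d k l : ℕ} (hd : 3 ≤ d) (hkl : k < l) {Y Z : Sph d → ℝ}
    (hY : Y ∈ sphHarmonics d k) (hZ : Z ∈ sphHarmonics d l) :
    ∫ x, Y x * Z x ∂(sphMeasure d) = 0 := by
  obtain ⟨φ, lam, h0, hk, hl⟩ := exists_isZonalEigenvalue_ne_zero hd k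
  have h := integral_zonalConv_mul φ
    (integrable_sphere_of_continuous (continuous_of_mem_sphHarmonics hY))
    (integrable_sphere_of_continuous (continuous_of_mem_sphHarmonics hZ))
  rw [hk.zonalConv_eq hY, (hl l hkl).zonalConv_eq hZ] at h
  simpa [mul_assoc, integral_const_mul, h0] using h

theorem integral_mul_eq_zero_of_ne {d k l : ℕ} (hd : 3 ≤ d) (hkl : k ≠ l) {Y Z : Sph d → ℝ}
    (hY : Y ∈ sphHarmonics d k) (hZ : Z ∈ sphHarmonics d l) :
    ∫ x, Y x * Z x ∂(sphMeasure d) = 0 := by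
  rcases lt_or_gt_of_ne hkl with h | h
  · exact integral_mul_eq_zero_of_lt hd h hY hZ
  · simpa only [mul_comm] using integral_mul_eq_zero_of_lt hd h hZ hY

theorem integral_sum_sq {d : ℕ} (hd : 3 ≤ d) (s : Finset ℕ) {h : ℕ → Sph d → ℝ}
    (hh : ∀ k, h k ∈ sphHarmonics d k) :
    ∫ x, (∑ k ∈ s, h k x) ^ 2 ∂(sphMeasure d) = ∑ k ∈ s, ∫ x, h k x ^ 2 ∂(sphMeasure d) := by
  have hc (k : ℕ) := continuous_of_mem_sphHarmonics (hh k)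
  simp only [sq, Finset.sum_mul_sum]
  have hi (k l : ℕ) : Integrable (fun x => h k x * h l x) (sphMeasure d) :=
    integrable_sphere_of_continuous ((hc k).mul (hc l))
  rw [integral_finsetSum _ fun k _ => integrable_finsetSum _ fun l _ => hi k l]
  refine Finset.sum_congr rfl fun k hk => ?_
  rw [integral_finsetSum _ fun l _ => hi k l]
  exact Finset.sum_eq_single_of_mem k hk fun l _ hl =>
    integral_mul_eq_zero_of_ne hd hl.symm (hh k) (hh l)

theorem integral_zonalConv_sq_le_of_mem {d : ℕ} (hd : 3 ≤ d) {φ : Polynomial ℝ} {B : ℝ}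
    (hφ : ∀ k, ∃ lam, |lam| ≤ B ∧ IsZonalEigenvalue d φ k lam) {g : Sph d → ℝ}
    (hg : g ∈ ⨆ k, sphHarmonics d k) :
    ∫ x, zonalConv φ g x ^ 2 ∂(sphMeasure d) ≤ B ^ 2 * ∫ x, g x ^ 2 ∂(sphMeasure d) := by
  obtain ⟨h, hh, rfl⟩ := (Submodule.mem_iSup_iff_exists_finsupp _ _).1 hg
  choose lam hlam hE using hφ
  have hc (k : ℕ) := continuous_of_mem_sphHarmonics (hh k)
  have e : zonalConv φ (h.sum fun _ Y => Y) = fun x => ∑ k ∈ h.support, (lam k • h k) x := by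
    ext x
    simp only [zonalConv, Finsupp.sum, Finset.sum_apply, Finset.mul_sum]
    rw [integral_finsetSum _ fun k _ => integrable_zonal_mul_of_integrable φ
      (integrable_sphere_of_continuous (hc k)) x]
    exact Finset.sum_congr rfl fun k _ => congrFun ((hE k).zonalConv_eq (hh k)) x
  rw [e, integral_sum_sq hd _ fun k => (sphHarmonics d k).smul_mem (lam k) (hh k)]
  simp only [Finsupp.sum, Finset.sum_apply]
  rw [integral_sum_sq hd _ hh, Finset.mul_sum]
  refine Finset.sum_le_sum fun k _ => ?_
  simp only [Pi.smul_apply, smul_eq_mul, mul_pow]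
  rw [integral_const_mul]
  refine mul_le_mul_of_nonneg_right ?_ (integral_nonneg fun x => sq_nonneg _)
  exact sq_le_sq.2 ((hlam k).trans (le_abs_self B))

theorem exists_zonalConv_pow_eq {d : ℕ} (j : ℕ) : ∀ {f : Sph d → ℝ},
    Integrable f (sphMeasure d) → ∃ P : MvPolynomial (Fin d) ℝ, ∀ x : Sph d,
      zonalConv (Polynomial.X ^ j) f x = polyEval P x := by
  induction j with
  | zero => exact fun {f} _ => ⟨MvPolynomial.C (∫ y, f y ∂(sphMeasure d)), fun x => by
      simp [zonalConv]⟩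
  | succ j ih =>
    intro f hf
    have hi (i : Fin d) : Integrable (fun y : Sph d => (y : EuclideanSpace ℝ (Fin d)) i * f y)
        (sphMeasure d) := by
      refine hf.bdd_mul (c := 1) (Continuous.aestronglyMeasurable (by fun_prop))
        (.of_forall fun y => ?_)
      simpa using PiLp.norm_apply_le (y : EuclideanSpace ℝ (Fin d)) i
    choose P hP using fun i => ih (hi i)
    refine ⟨∑ i, MvPolynomial.X i * P i, fun x => ?_⟩
    simp only [polyEval_sum, polyEval_mul, polyEval_X, ← hP, zonalConv, ← integral_const_mul]
    rw [← integral_finsetSum _ fun i _ =>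
      (integrable_zonal_mul_of_integrable _ (hi i) x).const_mul _]
    refine integral_congr_ae (.of_forall fun y => ?_)
    have e : inner ℝ (x : EuclideanSpace ℝ (Fin d)) y = ∑ i,
        (x : EuclideanSpace ℝ (Fin d)) i * (y : EuclideanSpace ℝ (Fin d)) i := by
      simp [PiLp.inner_apply, mul_comm]
    simp only [pow_succ, Polynomial.eval_mul, Polynomial.eval_X]
    nth_rw 2 [e]
    rw [Finset.mul_sum, Finset.sum_mul]
    exact Finset.sum_congr rfl fun i _ => by ring

theorem exists_zonalConv_eq {d : ℕ} (φ : Polynomial ℝ) {f : Sph d → ℝ}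
    (hf : Integrable f (sphMeasure d)) : ∃ P : MvPolynomial (Fin d) ℝ, ∀ x : Sph d,
      zonalConv φ f x = polyEval P x := by
  induction φ using Polynomial.induction_on' with
  | add φ ψ hφ hψ =>
    obtain ⟨P, hP⟩ := hφ
    obtain ⟨Q, hQ⟩ := hψ
    refine ⟨P + Q, fun x => ?_⟩
    rw [polyEval_add, ← hP, ← hQ, zonalConv, zonalConv, zonalConv,
      ← integral_add (integrable_zonal_mul_of_integrable _ hf x)
        (integrable_zonal_mul_of_integrable _ hf x)]
    exact integral_congr_ae (.of_forall fun y => by simp [add_mul])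
  | monomial j a =>
    obtain ⟨P, hP⟩ := exists_zonalConv_pow_eq j hf
    refine ⟨MvPolynomial.C a * P, fun x => ?_⟩
    rw [polyEval_mul, polyEval_C, ← hP, zonalConv, zonalConv, ← integral_const_mul]
    exact integral_congr_ae (.of_forall fun y => by simp [mul_assoc])

theorem continuous_zonalConv {d : ℕ} (φ : Polynomial ℝ) {f : Sph d → ℝ}
    (hf : Integrable f (sphMeasure d)) : Continuous (zonalConv φ f) := by
  obtain ⟨P, hP⟩ := exists_zonalConv_eq φ hf
  rw [funext hP]
  exact (continuous_polyEval P).comp continuous_subtype_val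

theorem Continuous.exists_norm_le_sphere {d : ℕ} {f : Sph d → ℝ} (hf : Continuous f) :
    ∃ M, ∀ x, ‖f x‖ ≤ M := by
  obtain ⟨M, hM⟩ := (isCompact_univ.image hf).isBounded.exists_norm_le
  exact ⟨M, fun x => hM _ ⟨x, trivial, rfl⟩⟩

theorem integral_zonalConv_sq_le {d : ℕ} (hd : 3 ≤ d) {φ : Polynomial ℝ} {B : ℝ} (hB : 0 < B)
    (hφ : ∀ k, ∃ lam, |lam| ≤ B ∧ IsZonalEigenvalue d φ k lam) {f : Sph d → ℝ}
    (hf : Integrable f (sphMeasure d)) (hf2 : Integrable (fun x => f x ^ 2) (sphMeasure d)) :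
    ∫ x, zonalConv φ f x ^ 2 ∂(sphMeasure d) ≤ B ^ 2 * ∫ x, f x ^ 2 ∂(sphMeasure d) := by
  have hgc := continuous_zonalConv φ hf
  have hgi := integrable_sphere_of_continuous hgc
  have hhc := continuous_zonalConv φ hgi
  have hg : zonalConv φ f ∈ ⨆ k, sphHarmonics d k := by
    obtain ⟨P, hP⟩ := exists_zonalConv_eq φ hf
    rw [funext hP]
    exact polyEval_mem_iSup_sphHarmonics (by omega) P
  have h1 := integral_zonalConv_sq_le_of_mem hd hφ hg
  have h2 := integral_zonalConv_mul φ hf hgi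
  set g := zonalConv φ f
  set h := zonalConv φ g
  have hfh : Integrable (fun x => f x * h x) (sphMeasure d) := by
    obtain ⟨M, hM⟩ := hhc.exists_norm_le_sphere
    exact hf.mul_bdd hhc.aestronglyMeasurable (.of_forall hM)
  have h3 : 0 ≤ ∫ x, (B ^ 2 * f x - h x) ^ 2 ∂(sphMeasure d) :=
    integral_nonneg fun x => sq_nonneg _
  have h4 : ∫ x, (B ^ 2 * f x - h x) ^ 2 ∂(sphMeasure d) =
      B ^ 4 * ∫ x, f x ^ 2 ∂(sphMeasure d) - 2 * B ^ 2 * ∫ x, f x * h x ∂(sphMeasure d) +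
        ∫ x, h x ^ 2 ∂(sphMeasure d) := by
    have hh2 : Integrable (fun x => h x ^ 2) (sphMeasure d) :=
      integrable_sphere_of_continuous (hhc.pow 2)
    have hsub : Integrable (fun x => B ^ 4 * f x ^ 2 - 2 * B ^ 2 * (f x * h x)) (sphMeasure d) :=
      (hf2.const_mul _).sub (hfh.const_mul _)
    rw [← integral_const_mul, ← integral_const_mul, ← integral_sub (hf2.const_mul _)
      (hfh.const_mul _), ← integral_add hsub hh2]
    exact integral_congr_ae (.of_forall fun x => by simp; ring)
  rw [← h2] at h4
  have h5 : ∫ x, g x * g x ∂(sphMeasure d) = ∫ x, g x ^ 2 ∂(sphMeasure d) := by simp only [sq]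
  rw [h4, h5] at h3
  refine le_of_mul_le_mul_left ?_ (by positivity : 0 < B ^ 2)
  nlinarith

/-- For every measurable set, `Y` is the sum of a function controlled by the `L¹` norm of `Y` off
the set and of a function controlled by the `L²` norm of `Y` on the set. -/
def HasSplitting {α : Type*} [MeasurableSpace α] (μ : Measure α) (A B : ℝ) (Y : α → ℝ) : Prop :=
  ∀ E : Set α, MeasurableSet E → ∃ f g : α → ℝ, (∀ x, Y x = f x + g x) ∧
    (∀ x, |f x| ≤ A * ∫ y in Eᶜ, |Y y| ∂μ) ∧ Integrable (fun x => g x ^ 2) μ ∧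
    ∫ x, g x ^ 2 ∂μ ≤ B * ∫ x in E, Y x ^ 2 ∂μ

theorem HasSplitting.measure_lt_abs_le {α : Type*} [MeasurableSpace α] {μ : Measure α}
    [IsFiniteMeasure μ] {A B p t : ℝ} {Y : α → ℝ} (h : HasSplitting μ A B Y) (hA : 0 < A)
    (hB : 0 < B) (hY : Measurable Y) (hYb : ∃ M, ∀ x, |Y x| ≤ M) (hp : 1 < p) (ht : 0 < t)
    (hI : 0 < ∫ x, |Y x| ^ p ∂μ) :
    μ {x | t < |Y x|} ≤ ∫⁻ x in {x | t * |Y x| ^ (p - 1) ≤ 2 * A * ∫ x, |Y x| ^ p ∂μ},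
      ENNReal.ofReal (4 * B / t ^ 2 * Y x ^ 2) ∂μ := by
  obtain ⟨M, hM⟩ := hYb
  have hI1 : Integrable (fun x => |Y x|) μ :=
    .of_bound hY.abs.aestronglyMeasurable M (.of_forall fun x => by simpa using hM x)
  have hI2 : Integrable (fun x => Y x ^ 2) μ :=
    .of_bound (hY.pow_const 2).aestronglyMeasurable (M ^ 2) (.of_forall fun x => by
      rw [Real.norm_eq_abs, abs_pow]
      exact pow_le_pow_left₀ (abs_nonneg _) (hM x) 2)
  have hIp : Integrable (fun x => |Y x| ^ p) μ :=
    .of_bound (hY.abs.pow_const p).aestronglyMeasurable (M ^ p) (.of_forall fun x => by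
      rw [Real.norm_eq_abs, abs_of_nonneg (by positivity)]
      exact Real.rpow_le_rpow (abs_nonneg _) (hM x) (by linarith))
  set I := ∫ x, |Y x| ^ p ∂μ
  set E := {x | t * |Y x| ^ (p - 1) ≤ 2 * A * I}
  have hE : MeasurableSet E :=
    measurableSet_le ((hY.abs.pow_const (p - 1)).const_mul t) measurable_const
  obtain ⟨f, g, hfg, hf, hg, hgB⟩ := h E hE
  have hfs (x : α) : |f x| ≤ t / 2 := by
    refine (hf x).trans ?_
    have h1 : ∫ y in Eᶜ, |Y y| ∂μ ≤ ∫ y in Eᶜ, t / (2 * A * I) * |Y y| ^ p ∂μ := by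
      refine setIntegral_mono_on hI1.integrableOn (hIp.const_mul _).integrableOn hE.compl
        fun y hy => ?_
      have hy' : 2 * A * I < t * |Y y| ^ (p - 1) := not_le.1 hy
      have hY0 : 0 < |Y y| := by
        refine (abs_nonneg _).lt_of_ne fun h0 => ?_
        rw [← h0, Real.zero_rpow (by linarith), mul_zero] at hy'
        exact absurd hy' (not_lt.2 (by positivity))
      rw [div_mul_eq_mul_div, le_div_iff₀ (by positivity)]
      have e : |Y y| ^ p = |Y y| * |Y y| ^ (p - 1) := by
        rw [← Real.rpow_one_add' hY0.le (by linarith)]; ring_nf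
      rw [e]
      nlinarith
    have h2 : ∫ y in Eᶜ, t / (2 * A * I) * |Y y| ^ p ∂μ ≤ t / (2 * A * I) * I := by
      rw [integral_const_mul]
      gcongr
      exact setIntegral_le_integral hIp (.of_forall fun x => by positivity)
    calc A * ∫ y in Eᶜ, |Y y| ∂μ ≤ A * (t / (2 * A * I) * I) := by gcongr; exact h1.trans h2
      _ = t / 2 := by field_simp
  have hsub : {x | t < |Y x|} ⊆ {x | t ^ 2 / 4 ≤ g x ^ 2} := by
    intro x hx
    have h1 : t / 2 ≤ |g x| := by
      have h2 := abs_add_le (f x) (g x)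
      rw [← hfg x] at h2
      have h3 : t < |Y x| := hx
      linarith [hfs x]
    change t ^ 2 / 4 ≤ g x ^ 2
    rw [← sq_abs (g x)]
    nlinarith
  have hch := mul_meas_ge_le_integral_of_nonneg (.of_forall fun x => sq_nonneg (g x)) hg (t ^ 2 / 4)
  have hch2 : μ.real {x | t ^ 2 / 4 ≤ g x ^ 2} ≤ ∫ x in E, 4 * B / t ^ 2 * Y x ^ 2 ∂μ := by
    rw [integral_const_mul, div_mul_eq_mul_div, le_div_iff₀ (by positivity)]
    linarith
  calc μ {x | t < |Y x|} ≤ μ {x | t ^ 2 / 4 ≤ g x ^ 2} := measure_mono hsub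
    _ = ENNReal.ofReal (μ.real {x | t ^ 2 / 4 ≤ g x ^ 2}) := by
      rw [Measure.real, ENNReal.ofReal_toReal (measure_ne_top _ _)]
    _ ≤ ENNReal.ofReal (∫ x in E, 4 * B / t ^ 2 * Y x ^ 2 ∂μ) := ENNReal.ofReal_le_ofReal hch2
    _ = _ := ofReal_integral_eq_lintegral_ofReal (hI2.const_mul _).integrableOn
      (.of_forall fun x => by positivity)

theorem lintegral_Ioc_rpow {r b : ℝ} (hr : 0 < r) (hb : 0 ≤ b) :
    ∫⁻ t in Set.Ioc 0 b, ENNReal.ofReal (t ^ (r - 1)) = ENNReal.ofReal (b ^ r / r) := by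
  rw [← ofReal_integral_eq_lintegral_ofReal
    ((intervalIntegrable_iff_integrableOn_Ioc_of_le hb).1
      (intervalIntegral.intervalIntegrable_rpow' (by linarith)))
    ((ae_restrict_iff' measurableSet_Ioc).2 (.of_forall fun t ht => by
      have := ht.1
      positivity)),
    ← intervalIntegral.integral_of_le hb, integral_rpow (.inl (by linarith))]
  rw [sub_add_cancel, Real.zero_rpow hr.ne', sub_zero]

theorem HasSplitting.lintegral_rpow_le {α : Type*} [MeasurableSpace α] {μ : Measure α}
    [IsFiniteMeasure μ] {A B p q : ℝ} {Y : α → ℝ} (h : HasSplitting μ A B Y) (hA : 0 < A)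
    (hB : 0 < B) (hY : Measurable Y) (hYb : ∃ M, ∀ x, |Y x| ≤ M) (hp : 1 < p) (hq : 2 < q)
    (hpq : (p - 1) * (q - 1) = 1) (hI : 0 < ∫ x, |Y x| ^ p ∂μ) :
    ∫⁻ x, ENNReal.ofReal (|Y x| ^ q) ∂μ ≤
      ENNReal.ofReal (q * (4 * B / (q - 2)) * (2 * A) ^ (q - 2) *
        (∫ x, |Y x| ^ p ∂μ) ^ (q - 1)) := by
  obtain ⟨I, hIe⟩ : ∃ I, I = ∫ x, |Y x| ^ p ∂μ := ⟨_, rfl⟩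
  have hIp : Integrable (fun x => |Y x| ^ p) μ := by
    obtain ⟨M, hM⟩ := hYb
    refine .of_bound (hY.abs.pow_const p).aestronglyMeasurable (M ^ p) (.of_forall fun x => ?_)
    rw [Real.norm_eq_abs, abs_of_nonneg (by positivity)]
    exact Real.rpow_le_rpow (abs_nonneg _) (hM x) (by linarith)
  have hI0 : 0 < I := hIe ▸ hI
  set F : ℝ → α → ℝ≥0∞ := fun t x => Set.indicator {z : ℝ × α | z.1 * |Y z.2| ^ (p - 1) ≤ 2 * A * I}
    (fun z => ENNReal.ofReal (4 * B * Y z.2 ^ 2) * ENNReal.ofReal (z.1 ^ (q - 2 - 1))) (t, x)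
  have hYs : Measurable fun z : ℝ × α => Y z.2 := hY.comp measurable_snd
  have hFm : Measurable (Function.uncurry F) := by
    exact Measurable.indicator (((hYs.pow_const 2).const_mul _).ennreal_ofReal.mul
      (measurable_fst.pow_const _).ennreal_ofReal)
      (measurableSet_le (measurable_fst.mul (hYs.abs.pow_const _)) measurable_const)
  have hinner (x : α) : ∫⁻ t in Set.Ioi (0 : ℝ), F t x ≤
      ENNReal.ofReal (4 * B / (q - 2) * (2 * A * I) ^ (q - 2) * |Y x| ^ p) := by
    rcases eq_or_ne (Y x) 0 with h0 | h0
    · have hF (t : ℝ) : F t x = 0 := by simp [F, Set.indicator_apply, h0]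
      simp [hF]
    · have hY0 : 0 < |Y x| := abs_pos.2 h0
      set b := 2 * A * I / |Y x| ^ (p - 1)
      have hb : 0 < b := by positivity
      calc ∫⁻ t in Set.Ioi (0 : ℝ), F t x
          ≤ ∫⁻ t in Set.Ioi (0 : ℝ), (Set.Ioc 0 b).indicator (fun t =>
              ENNReal.ofReal (4 * B * Y x ^ 2) * ENNReal.ofReal (t ^ (q - 2 - 1))) t := by
            refine setLIntegral_mono' measurableSet_Ioi fun t ht => ?_
            by_cases htb : t * |Y x| ^ (p - 1) ≤ 2 * A * I
            · rw [Set.indicator_of_mem (s := Set.Ioc 0 b)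
                ⟨ht, (le_div_iff₀ (by positivity)).2 htb⟩]
              exact Set.indicator_le_self' (fun _ _ => zero_le) _
            · simp [F, htb]
        _ ≤ ∫⁻ t, (Set.Ioc 0 b).indicator (fun t =>
              ENNReal.ofReal (4 * B * Y x ^ 2) * ENNReal.ofReal (t ^ (q - 2 - 1))) t :=
            setLIntegral_le_lintegral _ _
        _ = ENNReal.ofReal (4 * B * Y x ^ 2) * ENNReal.ofReal (b ^ (q - 2) / (q - 2)) := by
            rw [lintegral_indicator measurableSet_Ioc, lintegral_const_mul' _ _ ENNReal.ofReal_ne_top,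
              lintegral_Ioc_rpow (by linarith) hb.le]
        _ = _ := by
            rw [← ENNReal.ofReal_mul (by positivity)]
            congr 1
            simp only [b]
            rw [Real.div_rpow (by positivity) (by positivity), ← Real.rpow_mul hY0.le, ← sq_abs,
              show |Y x| ^ p = |Y x| ^ 2 / |Y x| ^ ((p - 1) * (q - 2)) by
                rw [← Real.rpow_natCast, ← Real.rpow_sub hY0]
                congr 1; push_cast; linarith]
            have : q - 2 ≠ 0 := by linarith
            field_simp
  rw [lintegral_rpow_eq_lintegral_meas_lt_mul μ (.of_forall fun x => abs_nonneg (Y x))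
    hY.abs.aemeasurable (by linarith : 0 < q)]
  calc ENNReal.ofReal q * ∫⁻ t in Set.Ioi (0 : ℝ), μ {x | t < |Y x|} * ENNReal.ofReal (t ^ (q - 1))
      ≤ ENNReal.ofReal q * ∫⁻ t in Set.Ioi (0 : ℝ), ∫⁻ x, F t x ∂μ := by
        gcongr ENNReal.ofReal q * ?_
        refine setLIntegral_mono' measurableSet_Ioi fun t ht => ?_
        have ht : 0 < t := ht
        refine (mul_le_mul_left (h.measure_lt_abs_le hA hB hY hYb hp ht hI) _).trans_eq ?_
        rw [← lintegral_mul_const' _ _ ENNReal.ofReal_ne_top, ← hIe, ← lintegral_indicator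
          (measurableSet_le ((hY.abs.pow_const (p - 1)).const_mul t) measurable_const)]
        refine lintegral_congr fun x => ?_
        by_cases htb : t * |Y x| ^ (p - 1) ≤ 2 * A * I
        · rw [Set.indicator_of_mem (by exact htb)]
          simp only [F]
          rw [Set.indicator_of_mem (by exact htb), ← ENNReal.ofReal_mul (by positivity),
            ← ENNReal.ofReal_mul (by positivity)]
          congr 1
          rw [show q - 1 = (q - 2 - 1) + (2 : ℕ) by push_cast; ring, Real.rpow_add_natCast ht.ne']
          field_simp
        · rw [Set.indicator_of_notMem (by exact htb)]
          simp only [F]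
          rw [Set.indicator_of_notMem (by exact htb)]
    _ = ENNReal.ofReal q * ∫⁻ x, (∫⁻ t in Set.Ioi (0 : ℝ), F t x) ∂μ := by
        rw [lintegral_lintegral_swap hFm.aemeasurable]
    _ ≤ ENNReal.ofReal q * ∫⁻ x, ENNReal.ofReal (4 * B / (q - 2) * (2 * A * I) ^ (q - 2) *
          |Y x| ^ p) ∂μ := by gcongr with x; exact hinner x
    _ = _ := by
        have hq2 : 0 < q - 2 := by linarith
        rw [← ofReal_integral_eq_lintegral_ofReal (hIp.const_mul _)
          (.of_forall fun x => by positivity), integral_const_mul, ← hIe,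
          ← ENNReal.ofReal_mul (by linarith)]
        congr 1
        rw [Real.mul_rpow (by positivity) hI0.le, show q - 1 = (q - 2) + 1 by ring,
          Real.rpow_add_one hI0.ne']
        ring

theorem isSphericalHarmonic_iff_mem {d n : ℕ} {Y : Sph d → ℝ} :
    IsSphericalHarmonic d n Y ↔ Y ∈ sphHarmonics d n := by
  constructor
  · rintro ⟨P, hP, hΔ, h⟩
    exact ⟨P, ⟨hP, by rw [polyLaplacian_apply, hΔ]⟩, h⟩
  · rintro ⟨P, ⟨hP, hΔ⟩, h⟩
    exact ⟨P, hP, by rw [← polyLaplacian_apply, hΔ], h⟩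

theorem memLp_of_continuous_sphere {d : ℕ} {Y : Sph d → ℝ} (hY : Continuous Y) (p : ℝ≥0∞) :
    MemLp Y p (sphMeasure d) := by
  obtain ⟨M, hM⟩ := hY.exists_norm_le_sphere
  exact .of_bound hY.aestronglyMeasurable M (.of_forall hM)

theorem abs_zonalConv_chebyshev_le {d : ℕ} (n : ℕ) {f : Sph d → ℝ}
    (hf : Integrable f (sphMeasure d)) (x : Sph d) :
    |zonalConv (Polynomial.Chebyshev.T ℝ n) f x| ≤ ∫ y, |f y| ∂(sphMeasure d) := by
  refine (abs_integral_le_integral_abs).trans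
    (integral_mono (integrable_zonal_mul_of_integrable _ hf x).abs hf.abs fun y => ?_)
  simp only [abs_mul]
  refine mul_le_of_le_one_left (abs_nonneg _) (Polynomial.Chebyshev.abs_eval_T_real_le_one n ?_)
  simpa using abs_real_inner_le_norm (x : EuclideanSpace ℝ (Fin d)) y

theorem zonalConv_add {d : ℕ} (φ : Polynomial ℝ) {f g : Sph d → ℝ}
    (hf : Integrable f (sphMeasure d)) (hg : Integrable g (sphMeasure d)) (x : Sph d) :
    zonalConv φ (fun y => f y + g y) x = zonalConv φ f x + zonalConv φ g x := by
  rw [zonalConv, zonalConv, zonalConv, ← integral_add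
    (integrable_zonal_mul_of_integrable φ hf x) (integrable_zonal_mul_of_integrable φ hg x)]
  simp only [mul_add]

theorem exists_hasSplitting {d : ℕ} (hd : 3 ≤ d) :
    ∃ C : ℝ, 0 < C ∧ ∀ n : ℕ, 1 ≤ n → ∃ A : ℝ, 0 < A ∧ A ≤ C * (n : ℝ) ^ ((d : ℝ) / 2 - 1) ∧
      ∀ Y ∈ sphHarmonics d n, HasSplitting (sphMeasure d) A (C ^ 2) Y ∧
        ∀ x, |Y x| ≤ A * ∫ y, |Y y| ∂(sphMeasure d) := by
  obtain ⟨C, hC, h⟩ := exists_chebEigenvalue_bounds hd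
  refine ⟨C, hC, fun n hn => ?_⟩
  obtain ⟨mu, hmu, hA, hn, hk⟩ := h n hn
  refine ⟨mu⁻¹, inv_pos.2 hmu, hA, fun Y hY => ⟨fun E hE => ?_, fun x => ?_⟩⟩
  · have hYc := continuous_of_mem_sphHarmonics hY
    have hYi := integrable_sphere_of_continuous hYc
    have hY2 : Integrable (fun x => Y x ^ 2) (sphMeasure d) :=
      integrable_sphere_of_continuous (hYc.pow 2)
    have hi1 := hYi.indicator hE.compl
    have hi2 := hYi.indicator hE
    have e2 : (fun x => E.indicator Y x ^ 2) = E.indicator fun x => Y x ^ 2 := by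
      ext x
      by_cases hx : x ∈ E <;> simp [hx]
    refine ⟨fun x => mu⁻¹ * zonalConv (Polynomial.Chebyshev.T ℝ n) (Eᶜ.indicator Y) x,
      fun x => mu⁻¹ * zonalConv (Polynomial.Chebyshev.T ℝ n) (E.indicator Y) x,
      fun x => ?_, fun x => ?_, ?_, ?_⟩
    · rw [← mul_add, ← zonalConv_add _ hi1 hi2]
      simp only [Set.indicator_compl_add_self_apply]
      rw [hn.zonalConv_eq hY]
      simp [hmu.ne']
    · rw [abs_mul, abs_of_pos (inv_pos.2 hmu)]
      gcongr
      refine (abs_zonalConv_chebyshev_le n hi1 x).trans_eq ?_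
      rw [← integral_indicator hE.compl]
      congr 1
      ext y
      by_cases hy : y ∈ E <;> simp [hy]
    · exact integrable_sphere_of_continuous ((continuous_const.mul (continuous_zonalConv _ hi2)).pow 2)
    · simp only [mul_pow]
      rw [integral_const_mul]
      have h1 := integral_zonalConv_sq_le hd (mul_pos hC hmu) hk hi2
        (by rw [e2]; exact hY2.indicator hE)
      rw [e2, integral_indicator hE] at h1
      calc mu⁻¹ ^ 2 * _ ≤ mu⁻¹ ^ 2 * ((C * mu) ^ 2 * ∫ x in E, Y x ^ 2 ∂(sphMeasure d)) := by gcongr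
        _ = _ := by field_simp
  · have h1 := abs_zonalConv_chebyshev_le n (integrable_sphere_of_continuous
      (continuous_of_mem_sphHarmonics hY)) x
    rw [hn.zonalConv_eq hY, Pi.smul_apply, smul_eq_mul, abs_mul, abs_of_pos hmu] at h1
    rwa [inv_mul_eq_div, le_div_iff₀' hmu]

theorem conjugate_exponent_cases {p p' : ℝ≥0∞} (hp1 : 1 ≤ p) (hp2 : p ≤ 2)
    (hpp' : 1 / p + 1 / p' = 1) : (p = 1 ∧ p' = ⊤) ∨ (p ≠ ⊤ ∧ p' ≠ ⊤ ∧ 1 < p.toReal ∧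
      p.toReal ≤ 2 ∧ 0 < p'.toReal ∧ 1 / p.toReal + 1 / p'.toReal = 1) := by
  have hpt : p ≠ ⊤ := ne_top_of_le_ne_top (by norm_num) hp2
  rcases eq_or_lt_of_le hp1 with rfl | h1
  · refine .inl ⟨rfl, ?_⟩
    have h : 1 + 1 / p' = 1 + 0 := by simpa using hpp'
    simpa using (ENNReal.add_right_inj ENNReal.one_ne_top).1 h
  · right
    have hp't : p' ≠ ⊤ := by
      rintro rfl
      simp at hpp'
      exact h1.ne' hpp'
    have hp'0 : p' ≠ 0 := by
      rintro rfl
      simp at hpp'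
    have hp0 : p ≠ 0 := (zero_lt_one.trans h1).ne'
    refine ⟨hpt, hp't, ?_, ?_, ENNReal.toReal_pos hp'0 hp't, ?_⟩
    · simpa using (ENNReal.toReal_lt_toReal ENNReal.one_ne_top hpt).2 h1
    · simpa using (ENNReal.toReal_le_toReal hpt (by norm_num)).2 hp2
    · have h := congrArg ENNReal.toReal hpp'
      rw [ENNReal.toReal_add (by simp [hp0]) (by simp [hp'0])] at h
      simpa using h

theorem eLpNorm_eq_ofReal_integral {d : ℕ} {Y : Sph d → ℝ} (hY : Continuous Y) {p : ℝ≥0∞}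
    (hp : p ≠ ⊤) (hp0 : 0 < p.toReal) :
    eLpNorm Y p (sphMeasure d) =
      ENNReal.ofReal ((∫ x, |Y x| ^ p.toReal ∂(sphMeasure d)) ^ p.toReal⁻¹) :=
  (memLp_of_continuous_sphere hY p).eLpNorm_eq_integral_rpow_norm
    (by rintro rfl; simp at hp0) hp

theorem exists_eLpNorm_le {d : ℕ} (hd : 3 ≤ d) {p p' : ℝ≥0∞}
    (hp1 : 1 ≤ p) (hp2 : p ≤ 2) (hpp' : 1 / p + 1 / p' = 1) :
    ∃ C : ℝ, 0 < C ∧ ∀ n : ℕ, 1 ≤ n → ∀ Y ∈ sphHarmonics d n,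
      eLpNorm Y p' (sphMeasure d) ≤
        ENNReal.ofReal (C * (n : ℝ) ^ (((d : ℝ) - 2) * (1 / p.toReal - 1 / 2))) *
          eLpNorm Y p (sphMeasure d) := by
  obtain ⟨D, hD, h⟩ := exists_hasSplitting hd
  rcases conjugate_exponent_cases hp1 hp2 hpp' with ⟨rfl, rfl⟩ | ⟨hpt, hp't, h1, h2, h0', hc⟩
  · refine ⟨D, hD, fun n hn Y hY => ?_⟩
    obtain ⟨A, hA, hAn, hs⟩ := h n hn
    have hYc := continuous_of_mem_sphHarmonics hY
    rw [eLpNorm_exponent_top, eLpNorm_eq_ofReal_integral hYc (by simp) (by simp),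
      ← ENNReal.ofReal_mul (by positivity)]
    refine eLpNormEssSup_le_of_ae_bound (.of_forall fun x => ((hs Y hY).2 x).trans ?_)
    simp only [ENNReal.toReal_one, Real.rpow_one, inv_one]
    gcongr
    refine hAn.trans_eq ?_
    congr 2
    ring
  · generalize hq : p'.toReal = q at *
    generalize hpr : p.toReal = r at *
    have h0 : 0 < r := by linarith
    rcases h2.eq_or_lt with rfl | h2
    · have : p' = p := by
        rw [← ENNReal.toReal_eq_toReal_iff' hp't hpt, hq, hpr]
        field_simp at hc
        linarith
      subst this
      exact ⟨1, one_pos, fun n hn Y hY => by simp⟩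
    have hr : r = q / (q - 1) := by
      have : q - 1 ≠ 0 := by
        intro h; rw [sub_eq_zero.1 h] at hc; simp at hc; linarith
      field_simp at hc ⊢
      linarith
    have hpq : (r - 1) * (q - 1) = 1 := by
      field_simp at hc
      linarith
    have hq2 : 2 < q := by
      by_contra! hq2
      nlinarith
    refine ⟨(q * (4 * D ^ 2 / (q - 2)) * (2 * D) ^ (q - 2)) ^ q⁻¹, ?_, fun n hn Y hY => ?_⟩
    · have : 0 < q - 2 := by linarith
      positivity
    obtain ⟨A, hA, hAn, hs⟩ := h n hn
    have hYc := continuous_of_mem_sphHarmonics hY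
    have hp0 : 0 < p.toReal := hpr ▸ h0
    have hp0' : 0 < p'.toReal := hq ▸ h0'
    rw [eLpNorm_eq_ofReal_integral hYc hp't hp0', eLpNorm_eq_ofReal_integral hYc hpt hp0,
      ← ENNReal.ofReal_mul (by have : 0 < q - 2 := by linarith
                               positivity), hpr, hq]
    have hci {s : ℝ} (hs : 0 < s) : Continuous fun x => |Y x| ^ s :=
      hYc.abs.rpow_const fun x => .inr hs.le
    have hnn (s : ℝ) : 0 ≤ ∫ x, |Y x| ^ s ∂(sphMeasure d) :=
      integral_nonneg fun x => Real.rpow_nonneg (abs_nonneg _) _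
    rcases (hnn r).eq_or_lt with hI | hI
    · have hY0 : Y =ᵐ[sphMeasure d] 0 := by
        have := (integral_eq_zero_iff_of_nonneg (fun x => Real.rpow_nonneg (abs_nonneg (Y x)) r)
          (integrable_sphere_of_continuous (hci h0))).1 hI.symm
        filter_upwards [this] with x hx
        exact abs_eq_zero.1 ((Real.rpow_eq_zero (abs_nonneg _) h0.ne').1 hx)
      have : ∫ x, |Y x| ^ q ∂(sphMeasure d) = 0 := by
        rw [← integral_zero (Sph d) ℝ (μ := sphMeasure d)]
        refine integral_congr_ae ?_
        filter_upwards [hY0] with x hx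
        simp [hx, h0'.ne']
      rw [this, Real.zero_rpow (inv_pos.2 h0').ne', ENNReal.ofReal_zero]
      exact zero_le
    · have hb := (hs Y hY).1.lintegral_rpow_le hA (by positivity) hYc.measurable
        hYc.exists_norm_le_sphere h1 hq2 hpq hI
      have hq2' : 0 < q - 2 := by linarith
      rw [← ofReal_integral_eq_lintegral_ofReal (integrable_sphere_of_continuous (hci h0'))
        (.of_forall fun x => by positivity), ENNReal.ofReal_le_ofReal_iff (by positivity)] at hb
      refine ENNReal.ofReal_le_ofReal ?_
      set I := ∫ x, |Y x| ^ r ∂(sphMeasure d)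
      have hn0 : (0 : ℝ) ≤ n := n.cast_nonneg
      calc (∫ x, |Y x| ^ q ∂(sphMeasure d)) ^ q⁻¹
          ≤ (q * (4 * D ^ 2 / (q - 2)) * (2 * (D * (n : ℝ) ^ ((d : ℝ) / 2 - 1))) ^ (q - 2) *
              I ^ (q - 1)) ^ q⁻¹ := by
            refine Real.rpow_le_rpow (hnn q) (hb.trans ?_) (by positivity)
            gcongr
        _ = _ := by
            rw [← mul_assoc 2 D, Real.mul_rpow (x := 2 * D) (by positivity) (by positivity),
              ← mul_assoc, Real.mul_rpow (by positivity) (by positivity),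
              Real.mul_rpow (by positivity) (by positivity), ← Real.rpow_mul hI.le,
              ← Real.rpow_mul hn0, ← Real.rpow_mul hn0]
            have e1 : (q - 1) * q⁻¹ = r⁻¹ := by
              rw [hr]; field_simp
            have e2 : ((d : ℝ) / 2 - 1) * (q - 2) * q⁻¹ = ((d : ℝ) - 2) * (1 / r - 1 / 2) := by
              rw [one_div r, ← e1]; field_simp; ring
            rw [e1, ← e2, mul_assoc ((d : ℝ) / 2 - 1)]

/-- The real and imaginary parts of `(x_i + √-1 x_j)^n`. -/
def planarPower {d : ℕ} (i j : Fin d) :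
    ℕ → MvPolynomial (Fin d) ℝ × MvPolynomial (Fin d) ℝ
  | 0 => (1, 0)
  | n + 1 =>
    (MvPolynomial.X i * (planarPower i j n).1 - MvPolynomial.X j * (planarPower i j n).2,
      MvPolynomial.X i * (planarPower i j n).2 + MvPolynomial.X j * (planarPower i j n).1)

/-- The squared norm of the projection to the `(x_i, x_j)`-plane. -/
def planarNormSq {d : ℕ} (i j : Fin d) : MvPolynomial (Fin d) ℝ :=
  MvPolynomial.X i ^ 2 + MvPolynomial.X j ^ 2

theorem planarPower_isHomogeneous {d : ℕ} (i j : Fin d) (n : ℕ) :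
    (planarPower i j n).1.IsHomogeneous n ∧ (planarPower i j n).2.IsHomogeneous n := by
  induction n with
  | zero => exact ⟨MvPolynomial.isHomogeneous_one _ _, MvPolynomial.isHomogeneous_zero _ _ _⟩
  | succ n ih =>
    have hX (k : Fin d) {P : MvPolynomial (Fin d) ℝ} (hP : P.IsHomogeneous n) :
        (MvPolynomial.X k * P).IsHomogeneous (n + 1) := by
      rw [add_comm n]
      exact (MvPolynomial.isHomogeneous_X ℝ k).mul hP
    exact ⟨(hX i ih.1).sub (hX j ih.2), (hX i ih.2).add (hX j ih.1)⟩

theorem planarPower_cauchyRiemann {d : ℕ} {i j : Fin d} (hij : i ≠ j) (n : ℕ) :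
    MvPolynomial.pderiv i (planarPower i j n).1 = MvPolynomial.pderiv j (planarPower i j n).2 ∧
    MvPolynomial.pderiv j (planarPower i j n).1 =
      -MvPolynomial.pderiv i (planarPower i j n).2 := by
  induction n with
  | zero => simp [planarPower]
  | succ n ih =>
    simp only [planarPower, map_sub, map_add, Derivation.leibniz, smul_eq_mul,
      MvPolynomial.pderiv_X_self, MvPolynomial.pderiv_X_of_ne hij,
      MvPolynomial.pderiv_X_of_ne hij.symm, ih.1, ih.2]
    constructor <;> ring

theorem polyLaplacian_X_mul {d : ℕ} (i : Fin d) (P : MvPolynomial (Fin d) ℝ) :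
    polyLaplacian d (MvPolynomial.X i * P) =
      2 * MvPolynomial.pderiv i P + MvPolynomial.X i * polyLaplacian d P := by
  classical
  rw [polyLaplacian_mul, polyLaplacian_eq_zero_of_lt_two (MvPolynomial.isHomogeneous_X ℝ i)
    one_lt_two]
  simp [MvPolynomial.pderiv_X, Pi.single_apply]

theorem isSolidHarmonic_planarPower {d : ℕ} {i j : Fin d} (hij : i ≠ j) (n : ℕ) :
    IsSolidHarmonic d n (planarPower i j n).1 := by
  suffices h : polyLaplacian d (planarPower i j n).1 = 0 ∧
      polyLaplacian d (planarPower i j n).2 = 0 from ⟨(planarPower_isHomogeneous i j n).1, h.1⟩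
  induction n with
  | zero =>
    exact ⟨polyLaplacian_eq_zero_of_lt_two (MvPolynomial.isHomogeneous_one _ _) two_pos,
      map_zero _⟩
  | succ n ih =>
    have h := planarPower_cauchyRiemann hij n
    simp only [planarPower, map_sub, map_add, polyLaplacian_X_mul, ih.1, ih.2, h.1, h.2]
    constructor <;> ring

theorem planarPower_add {d : ℕ} (i j : Fin d) (m n : ℕ) :
    planarPower i j (m + n) =
      ((planarPower i j m).1 * (planarPower i j n).1 -
          (planarPower i j m).2 * (planarPower i j n).2,
        (planarPower i j m).1 * (planarPower i j n).2 +
          (planarPower i j m).2 * (planarPower i j n).1) := by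
  induction n with
  | zero => simp [planarPower]
  | succ n ih =>
    rw [← add_assoc]
    simp only [planarPower, ih]
    ext1 <;> simp only <;> ring

theorem planarPower_sq_add_sq {d : ℕ} (i j : Fin d) (n : ℕ) :
    (planarPower i j n).1 ^ 2 + (planarPower i j n).2 ^ 2 = planarNormSq i j ^ n := by
  induction n with
  | zero => simp [planarPower]
  | succ n ih =>
    rw [pow_succ (planarNormSq i j), ← ih]
    simp only [planarPower, planarNormSq]
    ring

theorem planarNormSq_pow_isHomogeneous {d : ℕ} (i j : Fin d) (n : ℕ) :
    (planarNormSq i j ^ n).IsHomogeneous (2 * n) :=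
  (((MvPolynomial.isHomogeneous_X ℝ i).pow 2).add
    ((MvPolynomial.isHomogeneous_X ℝ j).pow 2)).pow n

theorem pderiv_planarNormSq {d : ℕ} {i j : Fin d} (hij : i ≠ j) :
    MvPolynomial.pderiv i (planarNormSq i j) = 2 * MvPolynomial.X i ∧
      MvPolynomial.pderiv j (planarNormSq i j) = 2 * MvPolynomial.X j := by
  simp [planarNormSq, Derivation.leibniz_pow, MvPolynomial.pderiv_X_of_ne hij,
    MvPolynomial.pderiv_X_of_ne hij.symm]

theorem planar_euler {d : ℕ} {i j : Fin d} (hij : i ≠ j) (n : ℕ) :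
    MvPolynomial.X i * MvPolynomial.pderiv i (planarNormSq i j ^ n) +
      MvPolynomial.X j * MvPolynomial.pderiv j (planarNormSq i j ^ n) =
      2 * (n : MvPolynomial (Fin d) ℝ) * planarNormSq i j ^ n := by
  induction n with
  | zero => rw [pow_zero]; simp
  | succ n ih =>
    rw [pow_succ']
    simp only [Derivation.leibniz, (pderiv_planarNormSq hij).1, (pderiv_planarNormSq hij).2,
      smul_eq_mul]
    have h : planarNormSq i j = MvPolynomial.X i ^ 2 + MvPolynomial.X j ^ 2 := rfl
    push_cast
    linear_combination planarNormSq i j * ih - 2 * planarNormSq i j ^ n * h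

theorem polyLaplacian_planarNormSq_mul {d : ℕ} (i j : Fin d) (P : MvPolynomial (Fin d) ℝ) :
    polyLaplacian d (planarNormSq i j * P) = 4 * P +
      4 * (MvPolynomial.X i * MvPolynomial.pderiv i P +
        MvPolynomial.X j * MvPolynomial.pderiv j P) +
      planarNormSq i j * polyLaplacian d P := by
  have e : planarNormSq i j * P = MvPolynomial.X i * (MvPolynomial.X i * P) +
      MvPolynomial.X j * (MvPolynomial.X j * P) := by
    rw [planarNormSq]
    ring
  rw [e, map_add]
  simp only [polyLaplacian_X_mul, Derivation.leibniz, MvPolynomial.pderiv_X_self, smul_eq_mul,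
    planarNormSq]
  ring

theorem polyLaplacian_planarNormSq_pow {d : ℕ} {i j : Fin d} (hij : i ≠ j) (n : ℕ) :
    polyLaplacian d (planarNormSq i j ^ (n + 1)) =
      MvPolynomial.C (4 * ((n : ℝ) + 1) ^ 2) * planarNormSq i j ^ n := by
  induction n with
  | zero =>
    have h : polyLaplacian d (1 : MvPolynomial (Fin d) ℝ) = 0 :=
      polyLaplacian_eq_zero_of_lt_two (MvPolynomial.isHomogeneous_one _ _) two_pos
    rw [pow_succ', polyLaplacian_planarNormSq_mul, pow_zero, h]
    simp only [mul_one, Derivation.map_one_eq_zero, mul_zero, add_zero, Nat.cast_zero, zero_add,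
      one_pow]
    rfl
  | succ n ih =>
    rw [pow_succ', polyLaplacian_planarNormSq_mul, planar_euler hij, ih]
    simp only [map_mul, map_pow, map_add, map_natCast, map_one, map_ofNat, Nat.cast_add,
      Nat.cast_one]
    ring

theorem sphereIntegral_planarNormSq_pow {d : ℕ} (hd : 3 ≤ d) {i j : Fin d} (hij : i ≠ j)
    (n : ℕ) : sphereIntegral (planarNormSq i j ^ n) =
      (sphMeasure d).real Set.univ * gammaRatio ((d : ℝ) / 2 - 1) n := by
  have hd' : (3 : ℝ) ≤ d := by exact_mod_cast hd
  induction n with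
  | zero => simp [sphereIntegral, polyEval, gammaRatio]
  | succ n ih =>
    have h := sphereIntegral_polyLaplacian (by omega) (planarNormSq_pow_isHomogeneous i j (n + 1))
    rw [polyLaplacian_planarNormSq_pow hij] at h
    have e : sphereIntegral (MvPolynomial.C (4 * ((n : ℝ) + 1) ^ 2) * planarNormSq i j ^ n) =
        4 * ((n : ℝ) + 1) ^ 2 * sphereIntegral (planarNormSq i j ^ n) := by
      simp only [sphereIntegral, polyEval_mul, polyEval_C, integral_const_mul]
    rw [e, ih] at h
    rw [gammaRatio_succ]
    have h1 : (0 : ℝ) < n + 1 := by positivity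
    have h2 : (0 : ℝ) < n + 1 + (d / 2 - 1) := by linarith
    rw [← mul_div_assoc, ← mul_div_assoc, eq_div_iff h2.ne']
    apply mul_left_cancel₀ (mul_pos four_pos h1).ne'
    push_cast at h
    linear_combination -h

theorem integral_planarPower_sq {d : ℕ} (hd : 3 ≤ d) {i j : Fin d} (hij : i ≠ j)
    {n : ℕ} (hn : 1 ≤ n) :
    ∫ x : Sph d, polyEval (planarPower i j n).1 (x : EuclideanSpace ℝ (Fin d)) ^ 2
      ∂(sphMeasure d) =
      (sphMeasure d).real Set.univ / 2 * gammaRatio ((d : ℝ) / 2 - 1) n := by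
  have hi (P : MvPolynomial (Fin d) ℝ) :
      Integrable (fun x : Sph d => polyEval P (x : EuclideanSpace ℝ (Fin d))) (sphMeasure d) :=
    integrable_sphere_of_continuous ((continuous_polyEval P).comp continuous_subtype_val)
  have h1 := sphereIntegral_planarNormSq_pow hd hij n
  have h2 := sphereIntegral_eq_zero hd (by omega) (isSolidHarmonic_planarPower hij (n + n))
  have e (x : Sph d) : polyEval (planarPower i j n).1 (x : EuclideanSpace ℝ (Fin d)) ^ 2 =
      2⁻¹ * (polyEval (planarNormSq i j ^ n) (x : EuclideanSpace ℝ (Fin d)) +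
        polyEval (planarPower i j (n + n)).1 (x : EuclideanSpace ℝ (Fin d))) := by
    rw [← planarPower_sq_add_sq, planarPower_add]
    simp only [polyEval_add, polyEval_sub, polyEval_mul, polyEval_pow]
    ring
  simp only [e]
  rw [integral_const_mul, integral_add (hi _) (hi _)]
  simp only [sphereIntegral] at h1 h2
  rw [h1, h2]
  ring

theorem polyEval_planarNormSq_mem_Icc {d : ℕ} {i j : Fin d} (hij : i ≠ j) (x : Sph d) :
    polyEval (planarNormSq i j) (x : EuclideanSpace ℝ (Fin d)) ∈ Set.Icc 0 1 := by
  have h : ‖(x : EuclideanSpace ℝ (Fin d))‖ ^ 2 = 1 := by simp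
  rw [EuclideanSpace.norm_sq_eq] at h
  simp only [planarNormSq, polyEval_add, polyEval_pow, polyEval_X]
  refine ⟨by positivity, h ▸ ?_⟩
  rw [← Finset.sum_pair (f := fun k => (x : EuclideanSpace ℝ (Fin d)) k ^ 2) hij]
  simp only [Real.norm_eq_abs, sq_abs]
  exact Finset.sum_le_univ_sum_of_nonneg fun _ => sq_nonneg _

theorem abs_polyEval_planarPower_rpow_le {d : ℕ} {i j : Fin d} (hij : i ≠ j) (n : ℕ) {r : ℝ}
    (hr : 1 ≤ r) (x : Sph d) :
    |polyEval (planarPower i j n).1 (x : EuclideanSpace ℝ (Fin d))| ^ r ≤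
      polyEval (planarNormSq i j ^ (n / 2)) (x : EuclideanSpace ℝ (Fin d)) := by
  obtain ⟨h0, h1⟩ := polyEval_planarNormSq_mem_Icc hij x
  have h2 := congrArg (fun P => polyEval P (x : EuclideanSpace ℝ (Fin d)))
    (planarPower_sq_add_sq i j n)
  simp only [polyEval_add, polyEval_pow] at h2 ⊢
  have h3 : |polyEval (planarPower i j n).1 (x : EuclideanSpace ℝ (Fin d))| ≤
      polyEval (planarNormSq i j) (x : EuclideanSpace ℝ (Fin d)) ^ (n / 2) := by
    refine abs_le_of_sq_le_sq ?_ (by positivity)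
    rw [← pow_mul]
    exact (le_add_of_nonneg_right (sq_nonneg _)).trans
      (h2.le.trans (pow_le_pow_of_le_one h0 h1 (Nat.div_mul_le_self n 2)))
  exact (Real.rpow_le_self_of_le_one (abs_nonneg _)
    (h3.trans (pow_le_one₀ h0 h1)) hr).trans h3

theorem exists_gammaRatio_half_le {ν : ℝ} (hν : 0 < ν) :
    ∃ C : ℝ, 0 < C ∧ ∀ n : ℕ, 1 ≤ n → gammaRatio ν (n / 2) ≤ C * (n : ℝ) ^ (-ν) := by
  obtain ⟨c, C, hc, hC, h⟩ := exists_gammaRatio_bounds hν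
  refine ⟨C * 3 ^ ν + 1, by positivity, fun n hn => ?_⟩
  rcases hn.eq_or_lt with rfl | hn
  · simp only [gammaRatio, Nat.reduceDiv, Finset.range_zero, Finset.prod_empty, Nat.cast_one,
      Real.one_rpow, mul_one]
    have : (0 : ℝ) < C * 3 ^ ν := by positivity
    linarith
  · have hn0 : (0 : ℝ) < n := by positivity
    have h3 : (n : ℝ) / 3 ≤ (n / 2 : ℕ) := by
      rw [div_le_iff₀ three_pos]
      exact_mod_cast (by omega : n ≤ n / 2 * 3)
    calc gammaRatio ν (n / 2) ≤ C * ((n / 2 : ℕ) : ℝ) ^ (-ν) := (h _ (by omega)).2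
      _ ≤ C * ((n : ℝ) / 3) ^ (-ν) := by
        gcongr ?_ * ?_
        exact Real.rpow_le_rpow_of_nonpos (by positivity) h3 (by linarith)
      _ = C * 3 ^ ν * (n : ℝ) ^ (-ν) := by
        rw [Real.div_rpow hn0.le three_pos.le, Real.rpow_neg three_pos.le]
        field_simp
      _ ≤ _ := by gcongr; linarith

theorem exists_le_eLpNorm {d : ℕ} (hd : 3 ≤ d) {p p' : ℝ≥0∞}
    (hp1 : 1 ≤ p) (hp2 : p ≤ 2) (hpp' : 1 / p + 1 / p' = 1) :
    ∃ c : ℝ, 0 < c ∧ ∀ n : ℕ, 1 ≤ n → ∃ Y ∈ sphHarmonics d n, Y ≠ 0 ∧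
      ENNReal.ofReal (c * (n : ℝ) ^ (((d : ℝ) - 2) * (1 / p.toReal - 1 / 2))) *
          eLpNorm Y p (sphMeasure d) ≤ eLpNorm Y p' (sphMeasure d) := by
  have hd' : (3 : ℝ) ≤ d := by exact_mod_cast hd
  have hpt : p ≠ ⊤ := ne_top_of_le_ne_top (by norm_num) hp2
  have hr1 : 1 ≤ p.toReal := by
    simpa using (ENNReal.toReal_le_toReal ENNReal.one_ne_top hpt).2 hp1
  set r := p.toReal with hr
  set ν : ℝ := (d : ℝ) / 2 - 1 with hνd
  have hν : 0 < ν := by linarith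
  set S := (sphMeasure d).real Set.univ
  have hS : 0 < S := sphMeasure_real_univ_pos (by omega)
  obtain ⟨c₁, _, hc₁, _, hγ⟩ := exists_gammaRatio_bounds hν
  obtain ⟨C₁, hC₁, hγ'⟩ := exists_gammaRatio_half_le hν
  let i : Fin d := ⟨0, by omega⟩
  let j : Fin d := ⟨1, by omega⟩
  have hij : i ≠ j := by simp [i, j]
  refine ⟨S / 2 * c₁ / ((S * C₁) ^ r⁻¹) ^ 2, by positivity, fun n hn => ?_⟩
  have hn0 : (0 : ℝ) < n := by positivity
  set Y : Sph d → ℝ := fun x => polyEval (planarPower i j n).1 (x : EuclideanSpace ℝ (Fin d))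
    with hYdef
  have hY : Y ∈ sphHarmonics d n := ⟨_, isSolidHarmonic_planarPower hij n, fun _ => rfl⟩
  have hYc : Continuous Y := continuous_of_mem_sphHarmonics hY
  have hJ : ∫ x, Y x ^ 2 ∂(sphMeasure d) = S / 2 * gammaRatio ν n :=
    integral_planarPower_sq hd hij hn
  have hJ0 : 0 < ∫ x, Y x ^ 2 ∂(sphMeasure d) := by
    rw [hJ]
    have := gammaRatio_pos hν.le n
    positivity
  have hI : ∫ x, |Y x| ^ r ∂(sphMeasure d) ≤ S * C₁ * (n : ℝ) ^ (-ν) := by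
    calc ∫ x, |Y x| ^ r ∂(sphMeasure d) ≤ sphereIntegral (planarNormSq i j ^ (n / 2)) :=
        integral_mono (integrable_sphere_of_continuous
            (hYc.abs.rpow_const fun x => .inr (by linarith)))
          (integrable_sphere_of_continuous
            ((continuous_polyEval _).comp continuous_subtype_val))
          fun x => abs_polyEval_planarPower_rpow_le hij n hr1 x
      _ = S * gammaRatio ν (n / 2) := sphereIntegral_planarNormSq_pow hd hij _
      _ ≤ S * (C₁ * (n : ℝ) ^ (-ν)) := by gcongr; exact hγ' n hn
      _ = _ := by ring
  have hI0 : 0 ≤ ∫ x, |Y x| ^ r ∂(sphMeasure d) := integral_nonneg fun x => by positivity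
  set a := (∫ x, |Y x| ^ r ∂(sphMeasure d)) ^ r⁻¹ with ha
  have ha0 : 0 ≤ a := by positivity
  have hp : eLpNorm Y p (sphMeasure d) = ENNReal.ofReal a :=
    eLpNorm_eq_ofReal_integral hYc hpt (by linarith)
  have hH : ENNReal.HolderTriple p p' 1 := ⟨by simpa using hpp'⟩
  have hHolder : ENNReal.ofReal (∫ x, Y x ^ 2 ∂(sphMeasure d)) ≤
      ENNReal.ofReal a * eLpNorm Y p' (sphMeasure d) := by
    have h := eLpNorm_smul_le_mul_eLpNorm (p := p) (q := p') (r := 1) (μ := sphMeasure d)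
      hYc.aestronglyMeasurable hYc.aestronglyMeasurable
    rw [eLpNorm_eq_ofReal_integral (hYc.smul hYc) (by simp) (by simp), hp] at h
    simpa [← pow_two] using h
  have hapos : 0 < a := by
    refine ha0.lt_of_ne fun h => ?_
    rw [← h, ENNReal.ofReal_zero, zero_mul, nonpos_iff_eq_zero, ENNReal.ofReal_eq_zero] at hHolder
    linarith
  refine ⟨Y, hY, ?_, ?_⟩
  · intro h
    simp [h] at hJ0
  · have key : S / 2 * c₁ / ((S * C₁) ^ r⁻¹) ^ 2 *
        (n : ℝ) ^ (((d : ℝ) - 2) * (1 / r - 1 / 2)) * a * a ≤ ∫ x, Y x ^ 2 ∂(sphMeasure d) := by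
      have h1 : a ≤ (S * C₁) ^ r⁻¹ * (n : ℝ) ^ (-ν * r⁻¹) := by
        rw [Real.rpow_mul hn0.le, ← Real.mul_rpow (by positivity) (by positivity)]
        exact Real.rpow_le_rpow hI0 hI (by positivity)
      have h2 : (n : ℝ) ^ (((d : ℝ) - 2) * (1 / r - 1 / 2)) * (n : ℝ) ^ (-ν * r⁻¹) *
          (n : ℝ) ^ (-ν * r⁻¹) = (n : ℝ) ^ (-ν) := by
        rw [← Real.rpow_add hn0, ← Real.rpow_add hn0, hνd]
        congr 1
        ring
      calc _ ≤ S / 2 * c₁ / ((S * C₁) ^ r⁻¹) ^ 2 *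
            (n : ℝ) ^ (((d : ℝ) - 2) * (1 / r - 1 / 2)) *
            ((S * C₁) ^ r⁻¹ * (n : ℝ) ^ (-ν * r⁻¹)) *
            ((S * C₁) ^ r⁻¹ * (n : ℝ) ^ (-ν * r⁻¹)) := by gcongr
        _ = S / 2 * (c₁ * (n : ℝ) ^ (-ν)) := by
          rw [← h2]
          have : ((S * C₁) ^ r⁻¹) ≠ 0 := by positivity
          field_simp
        _ ≤ _ := by
          rw [hJ]
          gcongr
          exact (hγ n hn).1
    have h := (ENNReal.ofReal_le_ofReal key).trans hHolder
    rw [ENNReal.ofReal_mul (by positivity), mul_comm] at h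
    rw [hp, ← ENNReal.ofReal_mul (by positivity)]
    exact (ENNReal.mul_le_mul_iff_right (by simpa using hapos) ENNReal.ofReal_ne_top).1 h

/-- Corollary 1.2: for `1 ≤ p ≤ 2` with conjugate exponent `p'`, every spherical
harmonic of degree `n` satisfies `‖Y_n‖_{p'} ≤ C n^{(d-2)(1/p - 1/2)} ‖Y_n‖_p`,
and this estimate is sharp. -/
theorem reverse_holder_conjugate
    (d : ℕ) (hd : 3 ≤ d) (p p' : ℝ≥0∞)
    (hp1 : 1 ≤ p) (hp2 : p ≤ 2) (hpp' : 1 / p + 1 / p' = 1) :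
    ∃ c C : ℝ, 0 < c ∧ 0 < C ∧ ∀ n : ℕ, 1 ≤ n →
      ((∀ Y : Sph d → ℝ, IsSphericalHarmonic d n Y →
          eLpNorm Y p' (sphMeasure d) ≤
            ENNReal.ofReal
                (C * (n : ℝ) ^ (((d : ℝ) - 2) * (1 / p.toReal - 1 / 2))) *
              eLpNorm Y p (sphMeasure d)) ∧
        (∃ Y : Sph d → ℝ, IsSphericalHarmonic d n Y ∧ Y ≠ 0 ∧
          ENNReal.ofReal
              (c * (n : ℝ) ^ (((d : ℝ) - 2) * (1 / p.toReal - 1 / 2))) *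
            eLpNorm Y p (sphMeasure d) ≤ eLpNorm Y p' (sphMeasure d))) := by
  obtain ⟨C, hC, hupper⟩ := exists_eLpNorm_le hd hp1 hp2 hpp'
  obtain ⟨c, hc, hlower⟩ := exists_le_eLpNorm hd hp1 hp2 hpp'
  refine ⟨c, C, hc, hC, fun n hn =>
    ⟨fun Y hY => hupper n hn Y (isSphericalHarmonic_iff_mem.1 hY), ?_⟩⟩
  obtain ⟨Y, hY, h⟩ := hlower n hn
  exact ⟨Y, isSphericalHarmonic_iff_mem.2 hY, h⟩
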